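/- arXiv:2504.18862 — 2 statements merged into one kernel-verified Lean document; each statement's English description precedes it below -/
import Mathlib

section
/- Let k ∈ {3,4,5} and ε > 0. There is a constant C > 0 such that for every real T ≥ 10 and every real y with 2 ≤ y ≤ T, one has ∫_T^{2T} R₁^k(x;y) dx = (B_k(c)/(2^{3k−1} π^{2k})) ∫_T^{2T} x^{9k/8} dx + E, where |E| ≤ C (T^{1+9k/8+ε} y^{−3/4} + T^{3/4+9k/8+ε} y^{4^{k−2} − 5/4 + k/8}). -/
open Real Finset

/-- `R₁(x; y) = (x^{9/8}/(4π²)) ∑_{n ≤ y} (c_n/n^{7/8}) cos(8π(nx)^{1/4} − π/4)`. -/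
noncomputable def R1 (c : ℕ → ℝ) (x y : ℝ) : ℝ :=
  x ^ ((9 : ℝ) / 8) / (4 * π ^ 2) *
    ∑ n ∈ Finset.Icc 1 ⌊y⌋₊,
      c n / (n : ℝ) ^ ((7 : ℝ) / 8) * Real.cos (8 * π * ((n : ℝ) * x) ^ ((1 : ℝ) / 4) - π / 4)

/-- `s_{k;l}(c) = ∑ c_{n₁}⋯c_{n_k}/(n₁⋯n_k)^{7/8}` over positive integer tuples with
`n₁^{1/4}+⋯+n_l^{1/4} = n_{l+1}^{1/4}+⋯+n_k^{1/4}`. -/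
noncomputable def sklRS (c : ℕ → ℝ) (k l : ℕ) : ℝ :=
  ∑' n : {n : Fin k → ℕ // (∀ j, 0 < n j) ∧
      ∑ j ∈ Finset.univ.filter (fun j : Fin k => (j : ℕ) < l), ((n j : ℝ)) ^ ((1 : ℝ) / 4) =
        ∑ j ∈ Finset.univ.filter (fun j : Fin k => l ≤ (j : ℕ)), ((n j : ℝ)) ^ ((1 : ℝ) / 4)},
    (∏ j, c (n.1 j)) / (∏ j, (n.1 j : ℝ)) ^ ((7 : ℝ) / 8)

/-- `B_k(c) = ∑_{l=1}^{k−1} binom(k−1,l) s_{k;l}(c) cos(π(k−2l)/4)`. -/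
noncomputable def BkRS (c : ℕ → ℝ) (k : ℕ) : ℝ :=
  ∑ l ∈ Finset.Icc 1 (k - 1),
    ((k - 1).choose l : ℝ) * sklRS c k l * Real.cos (π * ((k : ℝ) - 2 * l) / 4)

theorem embedding_norm_eq {L : Type*} [Field L] [Algebra ℚ L] (φ : L →ₐ[ℚ] ℂ) {x : L} {q : ℚ}
    {r : ℝ} (hr : 0 ≤ r) (hx : x ^ 4 = algebraMap ℚ L q) (hrq : r ^ 4 = q) : ‖φ x‖ = r := by
  have h1 : φ x ^ 4 = (q : ℂ) := by
    rw [← map_pow, hx, AlgHom.commutes]; rfl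
  have h2 : ‖φ x‖ ^ 4 = r ^ 4 := by
    rw [← norm_pow, h1, ← Complex.ofReal_ratCast, ← hrq, Complex.norm_real, norm_pow,
      Real.norm_of_nonneg hr]
  exact (pow_left_inj₀ (norm_nonneg _) hr (by norm_num)).1 h2

theorem finrank_adjoin_fourthRoots_le {ι : Type*} [Fintype ι] [DecidableEq ι] (r : ι → ℝ)
    (q : ι → ℚ) (hrq : ∀ j, r j ^ 4 = q j) (a : ι) (ha : r a = 1) :
    Module.finrank ℚ (IntermediateField.adjoin ℚ (Set.range r)) ≤ 4 ^ (Fintype.card ι - 1) := by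
  classical
  set L := IntermediateField.adjoin ℚ (Set.range r) with hL
  have hint : ∀ x ∈ Set.range r, IsIntegral ℚ x := by
    rintro _ ⟨j, rfl⟩
    refine IsIntegral.of_pow (n := 4) (by norm_num) ?_
    rw [hrq]
    exact isIntegral_algebraMap (R := ℚ) (A := ℝ) (x := q j)
  have : FiniteDimensional ℚ L := IntermediateField.finiteDimensional_adjoin hint
  let R : ι → L := fun j => ⟨r j, IntermediateField.subset_adjoin _ _ ⟨j, rfl⟩⟩
  have hR4 : ∀ j, R j ^ 4 = algebraMap ℚ L (q j) := fun j => Subtype.ext (by simpa [R] using hrq j)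
  rw [← AlgHom.card ℚ L ℂ]
  let S : ι → Finset ℂ := fun j =>
    if j = a then {1} else (Polynomial.nthRoots 4 (q j : ℂ)).toFinset
  have hmem : ∀ φ : L →ₐ[ℚ] ℂ, (fun j => φ (R j)) ∈ Fintype.piFinset S := by
    intro φ
    rw [Fintype.mem_piFinset]
    intro j
    by_cases hj : j = a
    · have : R j = 1 := Subtype.ext (by simp [R, hj, ha])
      simp [S, hj] at this ⊢
      simp [this]
    · simp only [S, if_neg hj, Multiset.mem_toFinset]
      rw [Polynomial.mem_nthRoots (by norm_num), ← map_pow, hR4, AlgHom.commutes]; rfl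
  have hinj : Function.Injective (fun (φ : L →ₐ[ℚ] ℂ) (j : ι) => φ (R j)) := by
    intro φ ψ h
    refine IntermediateField.adjoin_algHom_ext ℚ ?_
    rintro _ ⟨j, rfl⟩
    exact congrFun h j
  calc Fintype.card (L →ₐ[ℚ] ℂ) = #(Finset.univ : Finset (L →ₐ[ℚ] ℂ)) := rfl
    _ ≤ #(Fintype.piFinset S) :=
        Finset.card_le_card_of_injOn _ (fun φ _ => hmem φ) (fun _ _ _ _ h => hinj h)
    _ = ∏ j, #(S j) := Fintype.card_piFinset _
    _ ≤ ∏ j, (if j = a then 1 else 4) := by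
        refine Finset.prod_le_prod' fun j _ => ?_
        by_cases hj : j = a
        · simp [S, hj]
        · simp only [S, if_neg hj]
          exact (Multiset.toFinset_card_le _).trans (Polynomial.card_nthRoots _ _)
    _ = 4 ^ (Fintype.card ι - 1) := by
        rw [Finset.prod_ite]
        simp [Finset.filter_ne', Finset.card_erase_of_mem]

/-- Lower bound for a nonzero signed sum of fourth roots, via the norm of its fourth power. -/
theorem one_le_signed_fourthRoot_sum {ι : Type*} [Fintype ι] [DecidableEq ι] (s : ι → ℤ)
    (hs : ∀ j, |s j| ≤ 1) (n : ι → ℕ) (hn : ∀ j, 0 < n j) (a : ι) (ha : ∀ j, n j ≤ n a)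
    (h0 : ∑ j, (s j : ℝ) * (n j : ℝ) ^ ((1 : ℝ) / 4) ≠ 0) :
    1 ≤ |∑ j, (s j : ℝ) * (n j : ℝ) ^ ((1 : ℝ) / 4)| ^ 4 *
      ((Fintype.card ι : ℝ) ^ 4 * n a) ^ (4 ^ (Fintype.card ι - 1) - 1) := by
  classical
  set α := ∑ j, (s j : ℝ) * (n j : ℝ) ^ ((1 : ℝ) / 4) with hα
  have hna : (0 : ℝ) < n a := by exact_mod_cast hn a
  have hpow : ∀ x : ℝ, 0 ≤ x → (x ^ ((1 : ℝ) / 4)) ^ 4 = x := fun x hx => by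
    rw [← Real.rpow_natCast, ← Real.rpow_mul hx]; norm_num
  let r : ι → ℝ := fun j => ((n j : ℝ) / n a) ^ ((1 : ℝ) / 4)
  let q : ι → ℚ := fun j => (n j : ℚ) / n a
  have hr0 : ∀ j, 0 ≤ r j := fun j => by positivity
  have hrq : ∀ j, r j ^ 4 = q j := fun j => by
    simp only [r, q]; rw [hpow _ (by positivity)]; push_cast; rfl
  have hr1 : ∀ j, r j ≤ 1 := fun j => by
    refine Real.rpow_le_one (by positivity) ?_ (by norm_num)
    rw [div_le_one hna]; exact_mod_cast ha j
  have hra : r a = 1 := by simp [r, hna.ne']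
  have hfr := finrank_adjoin_fourthRoots_le r q hrq a hra
  set L := IntermediateField.adjoin ℚ (Set.range r) with hL
  have hint : ∀ x ∈ Set.range r, IsIntegral ℚ x := by
    rintro _ ⟨j, rfl⟩
    refine IsIntegral.of_pow (n := 4) (by norm_num) ?_
    rw [hrq]
    exact isIntegral_algebraMap (R := ℚ) (A := ℝ) (x := q j)
  have : FiniteDimensional ℚ L := IntermediateField.finiteDimensional_adjoin hint
  let R : ι → L := fun j => ⟨r j, IntermediateField.subset_adjoin _ _ ⟨j, rfl⟩⟩
  have hR4 : ∀ j, R j ^ 4 = algebraMap ℚ L (q j) := fun j => Subtype.ext (by simpa [R] using hrq j)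
  let β : L := (n a : L) * (∑ j, (s j : L) * R j) ^ 4
  have hsum : α = (n a : ℝ) ^ ((1 : ℝ) / 4) * ∑ j, (s j : ℝ) * r j := by
    rw [hα, Finset.mul_sum]
    refine Finset.sum_congr rfl fun j _ => ?_
    simp only [r]
    rw [Real.div_rpow (by positivity) (by positivity)]
    have : (n a : ℝ) ^ ((1 : ℝ) / 4) ≠ 0 := by positivity
    field_simp
  have hβ : (β : ℝ) = α ^ 4 := by
    rw [hsum, mul_pow, hpow _ hna.le]
    simp [β, R]
  have hβ0 : β ≠ 0 := by
    intro h
    have : α ^ 4 = 0 := by rw [← hβ, h]; rfl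
    exact h0 (pow_eq_zero_iff (by norm_num) |>.1 this)
  have hβint : IsIntegral ℤ β := by
    have h1 : IsIntegral ℤ (β : ℝ) := by
      rw [hβ, hα]
      refine IsIntegral.pow (IsIntegral.sum _ fun j _ => ?_) 4
      refine IsIntegral.mul (isIntegral_algebraMap (R := ℤ) (A := ℝ) (x := s j)) ?_
      refine IsIntegral.of_pow (n := 4) (by norm_num) ?_
      rw [hpow _ (by positivity)]
      exact isIntegral_algebraMap (R := ℤ) (A := ℝ) (x := n j)
    exact (isIntegral_algHom_iff (L.val.restrictScalars ℤ) L.val.injective).1 h1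
  have hN1 : 1 ≤ ‖algebraMap ℚ ℂ (Algebra.norm ℚ β)‖ := by
    obtain ⟨z, hz⟩ := IsIntegrallyClosed.isIntegral_iff.1 (Algebra.isIntegral_norm ℚ hβint)
    have hz0 : z ≠ 0 := by
      rintro rfl
      rw [map_zero] at hz
      exact hβ0 (Algebra.norm_eq_zero_iff.1 hz.symm)
    rw [← hz]
    simp only [eq_intCast, map_intCast, Complex.norm_intCast]
    exact_mod_cast Int.one_le_abs hz0
  rw [Algebra.norm_eq_prod_embeddings, norm_prod] at hN1
  set M : ℝ := (Fintype.card ι : ℝ) ^ 4 * n a with hM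
  have hcard : 1 ≤ Fintype.card ι := Fintype.card_pos_iff.2 ⟨a⟩
  have hM1 : 1 ≤ M := by
    have : 1 ≤ Fintype.card ι ^ 4 * n a := Nat.succ_le_of_lt (by have := hn a; positivity)
    rw [hM]; exact_mod_cast this
  have hbd : ∀ φ : L →ₐ[ℚ] ℂ, ‖φ β‖ ≤ M := by
    intro φ
    simp only [β, map_mul, map_pow, map_natCast, map_sum, map_intCast, norm_mul, norm_pow,
      Complex.norm_natCast]
    rw [hM, mul_comm]
    refine mul_le_mul_of_nonneg_right (pow_le_pow_left₀ (norm_nonneg _) ?_ 4) hna.le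
    refine (norm_sum_le _ _).trans ?_
    calc ∑ j, ‖(s j : ℂ) * φ (R j)‖ ≤ ∑ _j : ι, (1 : ℝ) := by
          refine Finset.sum_le_sum fun j _ => ?_
          rw [norm_mul, embedding_norm_eq φ (hr0 j) (hR4 j) (hrq j), Complex.norm_intCast]
          exact mul_le_one₀ (by exact_mod_cast hs j) (hr0 j) (hr1 j)
      _ = Fintype.card ι := by simp
  let φ₀ : L →ₐ[ℚ] ℂ := (IsScalarTower.toAlgHom ℚ ℝ ℂ).comp L.val
  have hφ₀ : ‖φ₀ β‖ = |α| ^ 4 := by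
    have : φ₀ β = ((β : ℝ) : ℂ) := rfl
    rw [this, hβ, Complex.norm_real, norm_pow, Real.norm_eq_abs]
  rw [← Finset.mul_prod_erase _ _ (Finset.mem_univ φ₀), hφ₀] at hN1
  refine hN1.trans (mul_le_mul_of_nonneg_left ?_ (by positivity))
  calc ∏ φ ∈ Finset.univ.erase φ₀, ‖φ β‖ ≤ ∏ _φ ∈ (Finset.univ : Finset (L →ₐ[ℚ] ℂ)).erase φ₀, M :=
        Finset.prod_le_prod (fun _ _ => norm_nonneg _) fun φ _ => hbd φ
    _ = M ^ (Fintype.card (L →ₐ[ℚ] ℂ) - 1) := by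
        rw [Finset.prod_const, Finset.card_erase_of_mem (Finset.mem_univ _), Finset.card_univ]
    _ ≤ _ := pow_le_pow_right₀ hM1 (by rw [AlgHom.card]; exact Nat.sub_le_sub_right hfr 1)

theorem nextCoeff_minpoly_fourthRoot {r : ℝ} {q : ℚ} (hr : 0 < r) (hrq : r ^ 4 = q)
    (hirr : ∀ p : ℚ, (p : ℝ) ≠ r) : (minpoly ℚ r).nextCoeff = 0 := by
  have hint : IsIntegral ℚ r := by
    refine IsIntegral.of_pow (n := 4) (by norm_num) ?_
    rw [hrq]
    exact isIntegral_algebraMap (R := ℚ) (A := ℝ) (x := q)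
  set P := minpoly ℚ r with hP
  have hmon : P.Monic := minpoly.monic hint
  have key : ∀ (m : ℕ) (b : ℚ), m ≠ 0 → r ^ m = b → P ∣ Polynomial.X ^ m - Polynomial.C b := by
    intro m b _ hb
    refine minpoly.dvd ℚ r ?_
    simp [hb]
  have hroots : ((P.map (algebraMap ℚ ℂ)).roots.map fun z => ‖z‖).prod = r ^ P.natDegree := by
    have h1 : ∀ z ∈ (P.map (algebraMap ℚ ℂ)).roots, ‖z‖ = r := by
      intro z hz
      obtain ⟨Q, hQ⟩ := key 4 q (by norm_num) hrq
      have hz0 : Polynomial.eval₂ (algebraMap ℚ ℂ) z P = 0 := by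
        rw [← Polynomial.eval_map]
        exact (Polynomial.mem_roots'.1 hz).2
      have h2 : Polynomial.eval₂ (algebraMap ℚ ℂ) z (Polynomial.X ^ 4 - Polynomial.C q) = 0 := by
        rw [hQ, Polynomial.eval₂_mul, hz0, zero_mul]
      have h3 : z ^ 4 = (q : ℂ) := by
        simpa [sub_eq_zero] using h2
      have h4 : ‖z‖ ^ 4 = r ^ 4 := by
        rw [← norm_pow, h3, ← Complex.ofReal_ratCast, ← hrq, Complex.norm_real, norm_pow,
          Real.norm_of_nonneg hr.le]
      exact (pow_left_inj₀ (norm_nonneg _) hr.le (by norm_num)).1 h4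
    rw [Multiset.map_congr rfl h1, Multiset.map_const', Multiset.prod_replicate]
    congr 1
    rw [← (IsAlgClosed.splits (P.map (algebraMap ℚ ℂ))).natDegree_eq_card_roots,
      Polynomial.natDegree_map]
  have hcoeff : r ^ P.natDegree = ((|P.coeff 0| : ℚ) : ℝ) := by
    have h1 := (IsAlgClosed.splits (P.map (algebraMap ℚ ℂ))).coeff_zero_eq_prod_roots_of_monic
      (hmon.map _)
    have h2 := congrArg norm h1
    rw [Polynomial.coeff_map, norm_mul, norm_pow, norm_neg, norm_one, one_pow, one_mul,
      ← coe_nnnorm, ← coe_nnnorm] at h2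
    rw [coe_nnnorm, coe_nnnorm, ← normHom_apply, ← normHom_apply, map_multiset_prod] at h2
    have h3 : (normHom : ℂ →*₀ ℝ) (algebraMap ℚ ℂ (P.coeff 0)) = ((|P.coeff 0| : ℚ) : ℝ) := by
      rw [normHom_apply]
      simp [← Complex.ofReal_ratCast, Complex.norm_real]
      rw [← Rat.norm_cast_real, Real.norm_eq_abs]
    rw [← h3, h2, ← hroots]
    rfl
  have hdeg4 : P.natDegree ≤ 4 := by
    have h := Polynomial.natDegree_le_of_dvd (key 4 q (by norm_num) hrq)
      (Polynomial.X_pow_sub_C_ne_zero (by norm_num) q)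
    rwa [Polynomial.natDegree_X_pow_sub_C] at h
  have hdeg0 : 0 < P.natDegree := minpoly.natDegree_pos hint
  have hne1 : P.natDegree ≠ 1 := fun h => by
    rw [h, pow_one] at hcoeff
    exact hirr _ hcoeff.symm
  have hne3 : P.natDegree ≠ 3 := fun h => by
    rw [h] at hcoeff
    refine hirr (q / |P.coeff 0|) ?_
    rw [Rat.cast_div, ← hcoeff, ← hrq]
    field_simp
  set e := P.natDegree with he
  set b : ℚ := |P.coeff 0|
  have hPeq : P = Polynomial.X ^ e - Polynomial.C b := by
    refine (Polynomial.eq_of_monic_of_dvd_of_natDegree_le hmon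
      (Polynomial.monic_X_pow_sub_C b hdeg0.ne') (key e b hdeg0.ne' hcoeff) ?_).symm
    rw [Polynomial.natDegree_X_pow_sub_C]
  rw [Polynomial.nextCoeff_of_natDegree_pos hdeg0, ← he, hPeq, Polynomial.coeff_sub,
    Polynomial.coeff_X_pow, Polynomial.coeff_C, if_neg (by omega), if_neg (by omega), sub_zero]

/-- In a vanishing signed sum of fourth roots, every term has a comparable partner in the same
rational fourth-power class. -/
theorem exists_partner_of_signed_fourthRoot_sum_eq_zero {ι : Type*} [Fintype ι] [DecidableEq ι]
    (s : ι → ℤ) (hs : ∀ j, |s j| = 1) (n : ι → ℕ) (hn : ∀ j, 0 < n j)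
    (h0 : ∑ j, (s j : ℝ) * (n j : ℝ) ^ ((1 : ℝ) / 4) = 0) (a : ι) :
    ∃ b, b ≠ a ∧ n a ≤ Fintype.card ι ^ 4 * n b ∧
      ∃ u v : ℕ, 0 < u ∧ 0 < v ∧ n b * u ^ 4 = n a * v ^ 4 := by
  classical
  have hna : (0 : ℝ) < n a := by exact_mod_cast hn a
  have hnj : ∀ j, (0 : ℝ) < n j := fun j => by exact_mod_cast hn j
  have hpow : ∀ x : ℝ, 0 ≤ x → (x ^ ((1 : ℝ) / 4)) ^ 4 = x := fun x hx => by
    rw [← Real.rpow_natCast, ← Real.rpow_mul hx]; norm_num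
  let r : ι → ℝ := fun j => ((n j : ℝ) / n a) ^ ((1 : ℝ) / 4)
  let q : ι → ℚ := fun j => (n j : ℚ) / n a
  have hr0 : ∀ j, 0 < r j := fun j => by have := hnj j; positivity
  have hrn : ∀ j, r j ^ 4 = (n j : ℝ) / n a := fun j => hpow _ (by positivity)
  have hrq : ∀ j, r j ^ 4 = q j := fun j => by
    rw [hrn]; simp only [q]; push_cast; rfl
  have hra : r a = 1 := by simp [r, hna.ne']
  have hint : ∀ x ∈ Set.range r, IsIntegral ℚ x := by
    rintro _ ⟨j, rfl⟩
    refine IsIntegral.of_pow (n := 4) (by norm_num) ?_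
    rw [hrq]
    exact isIntegral_algebraMap (R := ℚ) (A := ℝ) (x := q j)
  set L := IntermediateField.adjoin ℚ (Set.range r) with hL
  have : FiniteDimensional ℚ L := IntermediateField.finiteDimensional_adjoin hint
  let R : ι → L := fun j => ⟨r j, IntermediateField.subset_adjoin _ _ ⟨j, rfl⟩⟩
  have hsum : ∑ j, (s j : ℝ) * r j = 0 := by
    have : ∑ j, (s j : ℝ) * r j
        = (∑ j, (s j : ℝ) * (n j : ℝ) ^ ((1 : ℝ) / 4)) / (n a : ℝ) ^ ((1 : ℝ) / 4) := by
      rw [Finset.sum_div]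
      refine Finset.sum_congr rfl fun j _ => ?_
      simp only [r]
      rw [Real.div_rpow (by positivity) (by positivity), mul_div_assoc]
    rw [this, h0, zero_div]
  have hsumL : ∑ j, (s j : ℚ) • R j = 0 := Subtype.ext (by
    simpa [R, Algebra.smul_def] using hsum)
  let I : Finset ι := Finset.univ.filter fun j => ∃ p : ℚ, (p : ℝ) = r j
  have htr : ∀ j, ((Algebra.trace ℚ L (R j) : ℚ) : ℝ)
      = if j ∈ I then (Module.finrank ℚ L : ℝ) * r j else 0 := by
    intro j
    by_cases hj : j ∈ I
    · obtain ⟨p, hp⟩ := (Finset.mem_filter.1 hj).2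
      have hRp : R j = algebraMap ℚ L p := Subtype.ext (by simpa [R] using hp.symm)
      rw [if_pos hj, hRp, Algebra.trace_algebraMap, ← hp]
      simp
    · have hirr : ∀ p : ℚ, (p : ℝ) ≠ r j := fun p hp =>
        hj (Finset.mem_filter.2 ⟨Finset.mem_univ _, p, hp⟩)
      rw [if_neg hj, trace_eq_finrank_mul_minpoly_nextCoeff,
        ← minpoly.algebraMap_eq (algebraMap L ℝ).injective (R j)]
      have : (minpoly ℚ (algebraMap L ℝ (R j))).nextCoeff = 0 :=
        nextCoeff_minpoly_fourthRoot (hr0 j) (hrq j) hirr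
      rw [this]; simp
  have hI0 : ∑ j ∈ I, (s j : ℝ) * r j = 0 := by
    have h1 := congrArg (fun x => ((Algebra.trace ℚ L x : ℚ) : ℝ)) hsumL
    simp only [map_sum, map_smul, map_zero, Rat.cast_sum, smul_eq_mul, Rat.cast_mul, Rat.cast_zero,
      htr, Rat.cast_intCast, mul_ite, mul_zero] at h1
    rw [← Finset.sum_filter, Finset.filter_mem_eq_inter, Finset.univ_inter] at h1
    have hd : (Module.finrank ℚ L : ℝ) ≠ 0 := by
      exact_mod_cast (Module.finrank_pos (R := ℚ) (M := L)).ne'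
    refine (mul_eq_zero.1 (?_ : (Module.finrank ℚ L : ℝ) * _ = 0)).resolve_left hd
    rw [Finset.mul_sum, ← h1]
    exact Finset.sum_congr rfl fun j _ => by ring
  by_contra! hcon
  have haI : a ∈ I := Finset.mem_filter.2 ⟨Finset.mem_univ _, 1, by rw [hra]; simp⟩
  have hk : 0 < Fintype.card ι := Fintype.card_pos_iff.2 ⟨a⟩
  have hkR : (0 : ℝ) < Fintype.card ι := by exact_mod_cast hk
  have hsmall : ∀ b ∈ I.erase a, r b ≤ 1 / Fintype.card ι := by
    intro b hb
    obtain ⟨hba, hbI⟩ := Finset.mem_erase.1 hb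
    obtain ⟨p, hp⟩ := (Finset.mem_filter.1 hbI).2
    by_contra! hlt
    have hp0 : 0 < p := by
      have := hr0 b; rw [← hp] at this; exact_mod_cast this
    refine hcon b hba ?_ p.den p.num.natAbs p.den_pos
      (Int.natAbs_pos.2 (Rat.num_pos.2 hp0).ne') ?_
    · have h1 : (1 / (Fintype.card ι : ℝ)) ^ 4 ≤ r b ^ 4 :=
        pow_le_pow_left₀ (by positivity) hlt.le 4
      rw [hrn, div_pow, one_pow, div_le_div_iff₀ (by positivity) hna, one_mul] at h1
      have h2 : (n a : ℝ) ≤ (Fintype.card ι : ℝ) ^ 4 * n b := by linarith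
      exact_mod_cast h2
    · have h1 : (p : ℝ) ^ 4 = (n b : ℝ) / n a := by rw [hp, hrn]
      have hnum : (p.num.natAbs : ℝ) = (p.num : ℝ) := by
        rw [← Int.cast_natCast, Int.natAbs_of_nonneg (Rat.num_pos.2 hp0).le]
      have hden : (p.den : ℝ) ≠ 0 := by exact_mod_cast p.den_pos.ne'
      rw [Rat.cast_def, div_pow, div_eq_div_iff (by positivity) hna.ne', ← hnum] at h1
      have h2 : (n b : ℝ) * (p.den : ℝ) ^ 4 = n a * (p.num.natAbs : ℝ) ^ 4 := by linarith
      exact_mod_cast h2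
  rw [← Finset.add_sum_erase _ _ haI, hra, mul_one] at hI0
  have h1 : |(s a : ℝ)| = 1 := by exact_mod_cast hs a
  have h2 : |(s a : ℝ)| ≤ ∑ b ∈ I.erase a, (1 / (Fintype.card ι : ℝ)) := by
    rw [eq_neg_of_add_eq_zero_left hI0, abs_neg]
    refine (Finset.abs_sum_le_sum_abs _ _).trans (Finset.sum_le_sum fun b hb => ?_)
    have : |(s b : ℝ)| = 1 := by exact_mod_cast hs b
    rw [abs_mul, this, one_mul, abs_of_pos (hr0 b)]
    exact hsmall b hb
  rw [h1, Finset.sum_const, nsmul_eq_mul, mul_one_div, le_div_iff₀ hkR, one_mul] at h2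
  have h3 : #(I.erase a) < Fintype.card ι := by
    rw [← Finset.card_univ]
    refine Finset.card_lt_card ⟨Finset.subset_univ _, fun h => ?_⟩
    exact Finset.notMem_erase a I (h (Finset.mem_univ a))
  have h4 : (#(I.erase a) : ℝ) < Fintype.card ι := by exact_mod_cast h3
  linarith

/-- The least positive integer in the rational fourth-power class of `n`. -/
noncomputable def fourthClass (n : ℕ) : ℕ :=
  sInf {t | 0 < t ∧ ∃ u v : ℕ, 0 < u ∧ 0 < v ∧ t * u ^ 4 = n * v ^ 4}

theorem fourthClass_eq_of_mul_pow_eq {a b u v : ℕ} (hu : 0 < u) (hv : 0 < v)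
    (h : b * u ^ 4 = a * v ^ 4) : fourthClass b = fourthClass a := by
  unfold fourthClass
  congr 1
  ext t
  refine and_congr_right fun _ => ⟨?_, ?_⟩
  · rintro ⟨w, z, hw, hz, hwz⟩
    exact ⟨w * u, z * v, by positivity, by positivity, by
      calc t * (w * u) ^ 4 = (t * w ^ 4) * u ^ 4 := by ring
        _ = b * u ^ 4 * z ^ 4 := by rw [hwz]; ring
        _ = a * (z * v) ^ 4 := by rw [h]; ring⟩
  · rintro ⟨w, z, hw, hz, hwz⟩
    exact ⟨w * v, z * u, by positivity, by positivity, by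
      calc t * (w * v) ^ 4 = (t * w ^ 4) * v ^ 4 := by ring
        _ = a * v ^ 4 * z ^ 4 := by rw [hwz]; ring
        _ = b * (z * u) ^ 4 := by rw [← h]; ring⟩

theorem exists_eq_fourthClass_mul_pow {n : ℕ} (hn : 0 < n) :
    0 < fourthClass n ∧ ∃ m : ℕ, 0 < m ∧ n = fourthClass n * m ^ 4 := by
  set A : Set ℕ := {t | 0 < t ∧ ∃ u v : ℕ, 0 < u ∧ 0 < v ∧ t * u ^ 4 = n * v ^ 4} with hA
  have hne : A.Nonempty := ⟨n, hn, 1, 1, by norm_num, by norm_num, rfl⟩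
  obtain ⟨ht, u, v, hu, hv, huv⟩ : fourthClass n ∈ A := Nat.sInf_mem hne
  refine ⟨ht, ?_⟩
  obtain ⟨g, u', v', hg, hcop, rfl, rfl⟩ := Nat.exists_coprime' (Nat.gcd_pos_of_pos_left v hu)
  have hu' : 0 < u' := Nat.pos_of_mul_pos_right hu
  have hv' : 0 < v' := Nat.pos_of_mul_pos_right hv
  have h1 : fourthClass n * u' ^ 4 = n * v' ^ 4 := by
    have hg4 : 0 < g ^ 4 := by positivity
    refine Nat.eq_of_mul_eq_mul_right hg4 ?_
    calc fourthClass n * u' ^ 4 * g ^ 4 = fourthClass n * (u' * g) ^ 4 := by ring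
      _ = n * v' ^ 4 * g ^ 4 := by rw [huv]; ring
  have hdvd : v' ^ 4 ∣ fourthClass n := by
    refine Nat.Coprime.dvd_of_dvd_mul_right (hcop.symm.pow 4 4) (n := u' ^ 4) ?_
    exact h1 ▸ Dvd.intro_left n rfl
  obtain ⟨t, htv⟩ := hdvd
  have hn' : n = t * u' ^ 4 := by
    have hv4 : 0 < v' ^ 4 := by positivity
    refine Nat.eq_of_mul_eq_mul_right hv4 ?_
    rw [← h1, htv]; ring
  have ht0 : 0 < t := Nat.pos_of_ne_zero fun h => by simp [h] at hn'; omega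
  have hle : fourthClass n ≤ t :=
    Nat.sInf_le (s := A) ⟨ht0, u', 1, hu', one_pos, by rw [one_pow, mul_one]; exact hn'.symm⟩
  have hv1 : fourthClass n = t := by
    refine le_antisymm hle ?_
    rw [htv]
    exact Nat.le_mul_of_pos_left t (by positivity)
  exact ⟨u', hu', by rw [hv1]; exact hn'⟩

theorem summable_prod_comp_apply {ι : Type*} [Fintype ι] [DecidableEq ι] {f : ℕ → ℝ}
    (hf0 : ∀ n, 0 ≤ f n) (hf : Summable f) : Summable fun v : ι → ℕ => ∏ j, f (v j) := by
  classical
  refine summable_of_sum_le (c := ∏ _j : ι, ∑' n, f n)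
    (fun v => Finset.prod_nonneg fun j _ => hf0 _) fun F => ?_
  calc ∑ v ∈ F, ∏ j, f (v j)
      ≤ ∑ v ∈ Fintype.piFinset fun j : ι => F.image fun v => v j, ∏ j, f (v j) := by
        refine Finset.sum_le_sum_of_subset_of_nonneg (fun v hv => ?_)
          fun v _ _ => Finset.prod_nonneg fun j _ => hf0 _
        exact Fintype.mem_piFinset.2 fun j => Finset.mem_image_of_mem _ hv
    _ = ∏ j : ι, ∑ n ∈ F.image fun v => v j, f n := (Finset.prod_univ_sum _ _).symm
    _ ≤ _ := Finset.prod_le_prod (fun j _ => Finset.sum_nonneg fun n _ => hf0 n)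
        fun j _ => hf.sum_le_tsum _ fun n _ => hf0 n

theorem prod_rpow_comp_le {ι : Type*} [Fintype ι] [DecidableEq ι] {σ : ℝ} (hσ : 0 ≤ σ)
    (p : ι → ι) (v : ι → ℕ) (hv : ∀ c, 0 < v c)
    (hv1 : ∀ c, (∀ j, p j ≠ c) → v c = 1) (hp : ∀ i, ∃ j, j ≠ i ∧ p j = p i) :
    ∏ j, (v (p j) : ℝ) ^ (-σ) ≤ ∏ c, (v c : ℝ) ^ (-(2 * σ)) := by
  rw [← Finset.prod_fiberwise' (s := Finset.univ) (g := p) (f := fun c => (v c : ℝ) ^ (-σ))]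
  refine Finset.prod_le_prod (fun c _ => by positivity) fun c _ => ?_
  rw [Finset.prod_const]
  by_cases hc : ∀ j, p j ≠ c
  · simp [hv1 c hc]
  · push Not at hc
    obtain ⟨i, hi⟩ := hc
    obtain ⟨j, hji, hj⟩ := hp i
    have h2 : 2 ≤ #(Finset.univ.filter fun j => p j = c) := by
      refine Finset.one_lt_card.2 ⟨i, ?_, j, ?_, hji.symm⟩ <;> simp [hi, hj]
    have hvc : (1 : ℝ) ≤ v c := by exact_mod_cast hv c
    calc ((v c : ℝ) ^ (-σ)) ^ _ ≤ ((v c : ℝ) ^ (-σ)) ^ 2 :=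
          pow_le_pow_of_le_one (by positivity)
            (Real.rpow_le_one_of_one_le_of_nonpos hvc (by linarith)) h2
      _ = _ := by rw [← Real.rpow_natCast, ← Real.rpow_mul (by positivity)]; congr 1; push_cast; ring

theorem summable_prod_rpow_of_paired {ι : Type*} [Fintype ι] [DecidableEq ι] {σ : ℝ}
    (hσ : 1 / 2 < σ) (S : Set (ι → ℕ))
    (hS : ∀ n ∈ S, (∀ j, 0 < n j) ∧ ∀ a, ∃ b, b ≠ a ∧ fourthClass (n b) = fourthClass (n a)) :
    Summable fun n : S => ∏ j, (n.1 j : ℝ) ^ (-σ) := by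
  classical
  have key : ∀ n : S, ∃ g : (ι → ι) × ((ι → ℕ) × (ι → ℕ)),
      (∀ j, n.1 j = g.2.1 (g.1 j) * g.2.2 j ^ 4) ∧
      ∏ j, (n.1 j : ℝ) ^ (-σ) ≤
        1 * ((∏ c, (g.2.1 c : ℝ) ^ (-(2 * σ))) * ∏ j, (g.2.2 j : ℝ) ^ (-(4 * σ))) := by
    rintro ⟨n, hn⟩
    obtain ⟨hpos, hpair⟩ := hS n hn
    choose hq m hm hnm using fun j => exists_eq_fourthClass_mul_pow (hpos j)
    have hrep : ∀ t, (∃ i, fourthClass (n i) = t) → ∃ i, fourthClass (n i) = t := fun t h => h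
    let p : ι → ι := fun j => Classical.choose (hrep (fourthClass (n j)) ⟨j, rfl⟩)
    have hp : ∀ j, fourthClass (n (p j)) = fourthClass (n j) := fun j =>
      Classical.choose_spec (hrep (fourthClass (n j)) ⟨j, rfl⟩)
    have hp' : ∀ i j, fourthClass (n i) = fourthClass (n j) → p i = p j := by
      intro i j h
      simp only [p, h]
    let v : ι → ℕ := fun c => if ∃ j, p j = c then fourthClass (n c) else 1
    have hvp : ∀ j, v (p j) = fourthClass (n j) := fun j => by
      simp only [v]
      rw [if_pos ⟨j, rfl⟩, hp]
    have hrepr : ∀ j, n j = v (p j) * m j ^ 4 := fun j => by rw [hvp]; exact hnm j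
    refine ⟨(p, v, m), hrepr, ?_⟩
    have h1 : ∏ j, (n j : ℝ) ^ (-σ)
        = (∏ j, (v (p j) : ℝ) ^ (-σ)) * ∏ j, (m j : ℝ) ^ (-(4 * σ)) := by
      rw [← Finset.prod_mul_distrib]
      refine Finset.prod_congr rfl fun j _ => ?_
      have : (n j : ℝ) = (v (p j) : ℝ) * (m j : ℝ) ^ 4 := by exact_mod_cast hrepr j
      rw [this, Real.mul_rpow (by positivity) (by positivity), ← Real.rpow_natCast,
        ← Real.rpow_mul (by positivity)]
      congr 2
      push_cast; ring
    rw [one_mul]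
    simp only
    rw [h1]
    refine mul_le_mul_of_nonneg_right ?_ (Finset.prod_nonneg fun j _ => by positivity)
    refine prod_rpow_comp_le (by linarith) p v (fun c => ?_) (fun c hc => ?_) fun i => ?_
    · simp only [v]
      split_ifs
      exacts [hq c, one_pos]
    · simp only [v]
      rw [if_neg]
      rintro ⟨j, hj⟩
      exact hc j hj
    · obtain ⟨b, hb, hb'⟩ := hpair i
      exact ⟨b, hb, hp' _ _ hb'⟩
  choose g hg hgle using key
  have hinj : Function.Injective g := by
    intro n n' h
    refine Subtype.ext (funext fun j => ?_)
    rw [hg n j, hg n' j, h]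
  have hs : ∀ τ : ℝ, 1 < τ → Summable fun v : ι → ℕ => ∏ j, (v j : ℝ) ^ (-τ) := fun τ hτ =>
    summable_prod_comp_apply (f := fun n : ℕ => (n : ℝ) ^ (-τ)) (fun n => by positivity)
      (Real.summable_nat_rpow.2 (by linarith))
  have hG := (Summable.of_finite (f := fun _ : ι → ι => (1 : ℝ))).mul_of_nonneg
    ((hs (2 * σ) (by linarith)).mul_of_nonneg (hs (4 * σ) (by linarith))
      (fun v => Finset.prod_nonneg fun j _ => by positivity)
      (fun v => Finset.prod_nonneg fun j _ => by positivity))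
    (fun _ => zero_le_one)
    (fun x => mul_nonneg (Finset.prod_nonneg fun j _ => by positivity)
      (Finset.prod_nonneg fun j _ => by positivity))
  exact Summable.of_nonneg_of_le (fun n => Finset.prod_nonneg fun j _ => by positivity) hgle
    (hG.comp_injective hinj)

/-- The sum `∑ ± n_j^{1/4}` with the plus signs at the indices in `t`. -/
noncomputable def signedRootSum {ι : Type*} [Fintype ι] [DecidableEq ι] (t : Finset ι)
    (n : ι → ℕ) : ℝ :=
  ∑ j, ((if j ∈ t then 1 else -1 : ℤ) : ℝ) * (n j : ℝ) ^ ((1 : ℝ) / 4)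

/-- The weight `c_{n₁}⋯c_{n_k}/(n₁⋯n_k)^{7/8}`. -/
noncomputable def tupleWeight {ι : Type*} [Fintype ι] (c : ℕ → ℝ) (n : ι → ℕ) : ℝ :=
  (∏ j, c (n j)) / (∏ j, (n j : ℝ)) ^ ((7 : ℝ) / 8)

/-- Positive tuples with vanishing signed fourth-root sum. -/
def vanishingTuples {ι : Type*} [Fintype ι] [DecidableEq ι] (t : Finset ι) : Set (ι → ℕ) :=
  {n | (∀ j, 0 < n j) ∧ signedRootSum t n = 0}

section Weights

variable {ι : Type*} [Fintype ι]

theorem tupleWeight_nonneg {c : ℕ → ℝ} (hc0 : ∀ n, 0 ≤ c n) (n : ι → ℕ) :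
    0 ≤ tupleWeight c n :=
  div_nonneg (Finset.prod_nonneg fun _ _ => hc0 _)
    (Real.rpow_nonneg (Finset.prod_nonneg fun _ _ => Nat.cast_nonneg _) _)

theorem tupleWeight_le {c : ℕ → ℝ} (hc0 : ∀ n, 0 ≤ c n) {K δ : ℝ}
    (hK : ∀ n : ℕ, 1 ≤ n → c n ≤ K * (n : ℝ) ^ δ) (n : ι → ℕ) (hn : ∀ j, 0 < n j) :
    tupleWeight c n ≤ K ^ Fintype.card ι * ∏ j, (n j : ℝ) ^ (δ - 7 / 8) := by
  have h1 : tupleWeight c n = ∏ j, c (n j) / (n j : ℝ) ^ ((7 : ℝ) / 8) := by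
    rw [tupleWeight, Finset.prod_div_distrib, Real.finsetProd_rpow]
    exact fun j _ => Nat.cast_nonneg _
  rw [h1, ← Finset.card_univ, ← Finset.prod_const, ← Finset.prod_mul_distrib]
  refine Finset.prod_le_prod (fun j _ => div_nonneg (hc0 _) (by positivity)) fun j _ => ?_
  have hj : (0 : ℝ) < n j := by exact_mod_cast hn j
  rw [Real.rpow_sub hj, ← mul_div_assoc]
  gcongr
  exact hK _ (hn j)

variable [DecidableEq ι]

theorem tupleWeight_mul_rpow_le {c : ℕ → ℝ} (hc0 : ∀ n, 0 ≤ c n) {K δ : ℝ} (hδ : 0 < δ)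
    (hδ1 : δ ≤ 3 / 4) (hK0 : 0 < K) (hK : ∀ n : ℕ, 1 ≤ n → c n ≤ K * (n : ℝ) ^ (δ / 4))
    (t : Finset ι) {n : ι → ℕ} (hn : n ∈ vanishingTuples t) (a : ι) :
    tupleWeight c n * (n a : ℝ) ^ (3 / 4 - δ) ≤
      K ^ Fintype.card ι * (Fintype.card ι : ℝ) ^ 4 * ∏ j, (n j : ℝ) ^ (-(1 / 2 + δ / 4)) := by
  obtain ⟨hpos, h0⟩ := hn
  obtain ⟨b, hba, hle, -⟩ := exists_partner_of_signed_fourthRoot_sum_eq_zero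
    (fun j => if j ∈ t then 1 else -1) (fun j => by split_ifs <;> simp) n hpos h0 a
  have hposR : ∀ j, (0 : ℝ) < n j := fun j => by exact_mod_cast hpos j
  have h1R : ∀ j, (1 : ℝ) ≤ n j := fun j => by exact_mod_cast hpos j
  have hk1 : (1 : ℝ) ≤ (Fintype.card ι : ℝ) ^ 4 := by
    have : 1 ≤ Fintype.card ι := Fintype.card_pos_iff.2 ⟨a⟩
    exact one_le_pow₀ (by exact_mod_cast this)
  set τ := 3 / 8 - δ / 2 with hτ
  have hτ0 : 0 ≤ τ := by linarith
  have hτ1 : τ ≤ 1 := by linarith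
  have hsplit : ∏ j, (n j : ℝ) ^ (δ / 4 - 7 / 8)
      = (∏ j, (n j : ℝ) ^ (-(1 / 2 + δ / 4))) * ∏ j, (n j : ℝ) ^ (-τ) := by
    rw [← Finset.prod_mul_distrib]
    refine Finset.prod_congr rfl fun j _ => ?_
    rw [← Real.rpow_add (hposR j)]
    congr 1; rw [hτ]; ring
  have hg1 : ∀ j, (n j : ℝ) ^ (-τ) ≤ 1 := fun j =>
    Real.rpow_le_one_of_one_le_of_nonpos (h1R j) (by linarith)
  have hprod : ∏ j, (n j : ℝ) ^ (-τ) ≤ (n a : ℝ) ^ (-τ) * (n b : ℝ) ^ (-τ) := by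
    rw [← Finset.mul_prod_erase _ _ (Finset.mem_univ a),
      ← Finset.mul_prod_erase _ _ (Finset.mem_erase.2 ⟨hba, Finset.mem_univ b⟩)]
    refine mul_le_mul_of_nonneg_left ?_ (by positivity)
    refine mul_le_of_le_one_right (by positivity) ?_
    exact Finset.prod_le_one (fun j _ => by positivity) fun j _ => hg1 j
  have hab : (n a : ℝ) ^ (-τ) * (n b : ℝ) ^ (-τ) * (n a : ℝ) ^ (3 / 4 - δ)
      ≤ (Fintype.card ι : ℝ) ^ 4 := by
    have e : (n a : ℝ) ^ (3 / 4 - δ) = (n a : ℝ) ^ τ * (n a : ℝ) ^ τ := by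
      rw [← Real.rpow_add (hposR a)]; congr 1; rw [hτ]; ring
    have hle' : (n a : ℝ) ^ τ ≤ ((Fintype.card ι : ℝ) ^ 4) * (n b : ℝ) ^ τ := by
      calc (n a : ℝ) ^ τ ≤ ((Fintype.card ι : ℝ) ^ 4 * n b) ^ τ :=
            Real.rpow_le_rpow (by positivity) (by exact_mod_cast hle) hτ0
        _ = ((Fintype.card ι : ℝ) ^ 4) ^ τ * (n b : ℝ) ^ τ :=
            Real.mul_rpow (by positivity) (by positivity)
        _ ≤ _ := by
            refine mul_le_mul_of_nonneg_right ?_ (by positivity)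
            calc _ ≤ ((Fintype.card ι : ℝ) ^ 4) ^ (1 : ℝ) :=
                  Real.rpow_le_rpow_of_exponent_le hk1 hτ1
              _ = _ := Real.rpow_one _
    have hA : 0 < (n a : ℝ) ^ τ := Real.rpow_pos_of_pos (hposR a) _
    have hB : 0 < (n b : ℝ) ^ τ := Real.rpow_pos_of_pos (hposR b) _
    rw [e, Real.rpow_neg (hposR a).le, Real.rpow_neg (hposR b).le]
    calc ((n a : ℝ) ^ τ)⁻¹ * ((n b : ℝ) ^ τ)⁻¹ * ((n a : ℝ) ^ τ * (n a : ℝ) ^ τ)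
        = (n a : ℝ) ^ τ / (n b : ℝ) ^ τ := by field_simp
      _ ≤ _ := (div_le_iff₀ hB).2 hle'
  have hF0 : 0 ≤ ∏ j, (n j : ℝ) ^ (-(1 / 2 + δ / 4)) :=
    Finset.prod_nonneg fun j _ => by positivity
  calc tupleWeight c n * (n a : ℝ) ^ (3 / 4 - δ)
      ≤ (K ^ Fintype.card ι * ∏ j, (n j : ℝ) ^ (δ / 4 - 7 / 8)) * (n a : ℝ) ^ (3 / 4 - δ) :=
        mul_le_mul_of_nonneg_right (tupleWeight_le hc0 hK n hpos) (by positivity)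
    _ = K ^ Fintype.card ι * (∏ j, (n j : ℝ) ^ (-(1 / 2 + δ / 4))) *
          ((∏ j, (n j : ℝ) ^ (-τ)) * (n a : ℝ) ^ (3 / 4 - δ)) := by rw [hsplit]; ring
    _ ≤ K ^ Fintype.card ι * (∏ j, (n j : ℝ) ^ (-(1 / 2 + δ / 4))) *
          (Fintype.card ι : ℝ) ^ 4 := by
        refine mul_le_mul_of_nonneg_left ?_ (by positivity)
        exact (mul_le_mul_of_nonneg_right hprod (by positivity)).trans hab
    _ = _ := by ring

theorem summable_indicator_vanishingTuples (t : Finset ι) {δ : ℝ} (hδ : 0 < δ) :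
    Summable ((vanishingTuples t).indicator fun n : ι → ℕ =>
      ∏ j, (n j : ℝ) ^ (-(1 / 2 + δ / 4))) := by
  refine summable_subtype_iff_indicator.1
    (summable_prod_rpow_of_paired (by linarith) (vanishingTuples t) fun n hn => ⟨hn.1, fun a => ?_⟩)
  obtain ⟨b, hba, -, u, v, hu, hv, huv⟩ := exists_partner_of_signed_fourthRoot_sum_eq_zero
    (fun j => if j ∈ t then 1 else -1) (fun j => by split_ifs <;> simp) n hn.1 hn.2 a
  exact ⟨b, hba, fourthClass_eq_of_mul_pow_eq hu hv huv⟩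

/-- Truncating the sum over vanishing tuples at height `y` costs `O(y^{-3/4+δ})`. -/
theorem exists_truncation_bound [Nonempty ι] {c : ℕ → ℝ} (hc0 : ∀ n, 0 ≤ c n)
    (hc : ∀ ε : ℝ, 0 < ε → ∃ K : ℝ, 0 < K ∧ ∀ n : ℕ, 1 ≤ n → c n ≤ K * (n : ℝ) ^ ε)
    (t : Finset ι) {δ : ℝ} (hδ : 0 < δ) (hδ1 : δ ≤ 3 / 4) :
    ∃ C : ℝ, 0 ≤ C ∧ ∀ y : ℝ, 1 ≤ y →
      |(∑ n ∈ Fintype.piFinset fun _ : ι => Finset.Icc 1 ⌊y⌋₊,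
          (vanishingTuples t).indicator (tupleWeight c) n) -
        ∑' n, (vanishingTuples t).indicator (tupleWeight c) n| ≤ C * y ^ (-(3 / 4 - δ)) := by
  obtain ⟨K, hK0, hK⟩ := hc (δ / 4) (by linarith)
  set Z := vanishingTuples t with hZ
  set W := Z.indicator (tupleWeight (ι := ι) c) with hW
  set F : (ι → ℕ) → ℝ := Z.indicator fun n => ∏ j, (n j : ℝ) ^ (-(1 / 2 + δ / 4)) with hF
  set C₁ := K ^ Fintype.card ι * (Fintype.card ι : ℝ) ^ 4 with hC₁
  have hC₁0 : 0 ≤ C₁ := by positivity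
  have hFs : Summable F := summable_indicator_vanishingTuples t hδ
  have hF0 : ∀ n, 0 ≤ F n := fun n =>
    Set.indicator_nonneg (fun n _ => Finset.prod_nonneg fun j _ => by positivity) n
  have hW0 : ∀ n, 0 ≤ W n := fun n =>
    Set.indicator_nonneg (fun n _ => tupleWeight_nonneg hc0 n) n
  have hmain : ∀ n a, W n * (n a : ℝ) ^ (3 / 4 - δ) ≤ C₁ * F n := by
    intro n a
    by_cases hn : n ∈ Z
    · rw [hW, hF, Set.indicator_of_mem hn, Set.indicator_of_mem hn]
      exact tupleWeight_mul_rpow_le hc0 hδ hδ1 hK0 hK t hn a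
    · rw [hW, hF, Set.indicator_of_notMem hn, Set.indicator_of_notMem hn]; simp
  have hWF : ∀ n, W n ≤ C₁ * F n := by
    intro n
    by_cases hn : n ∈ Z
    · obtain ⟨a⟩ := ‹Nonempty ι›
      refine le_trans ?_ (hmain n a)
      refine le_mul_of_one_le_right (hW0 n) (Real.one_le_rpow ?_ (by linarith))
      exact_mod_cast hn.1 a
    · rw [hW, Set.indicator_of_notMem hn]; exact mul_nonneg hC₁0 (hF0 n)
  have hWs : Summable W := Summable.of_nonneg_of_le hW0 hWF (hFs.mul_left C₁)
  refine ⟨C₁ * ∑' n, F n, mul_nonneg hC₁0 (tsum_nonneg hF0), fun y hy => ?_⟩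
  have hy0 : 0 < y := by linarith
  set B := Fintype.piFinset fun _ : ι => Finset.Icc 1 ⌊y⌋₊ with hB
  have hout : ∀ n, n ∉ B → W n ≤ C₁ * F n * y ^ (-(3 / 4 - δ)) := by
    intro n hnB
    by_cases hn : n ∈ Z
    · have : ∃ a, y < n a := by
        by_contra! h
        refine hnB (Fintype.mem_piFinset.2 fun j => Finset.mem_Icc.2 ⟨hn.1 j, ?_⟩)
        exact Nat.le_floor (h j)
      obtain ⟨a, ha⟩ := this
      rw [Real.rpow_neg hy0.le, ← div_eq_mul_inv, le_div_iff₀ (by positivity)]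
      refine le_trans (mul_le_mul_of_nonneg_left ?_ (hW0 n)) (hmain n a)
      exact Real.rpow_le_rpow hy0.le ha.le (by linarith)
    · rw [hW, Set.indicator_of_notMem hn]
      exact mul_nonneg (mul_nonneg hC₁0 (hF0 n)) (by positivity)
  have hupper : ∑' n, W n ≤ ∑ n ∈ B, W n + C₁ * (∑' n, F n) * y ^ (-(3 / 4 - δ)) := by
    refine Real.tsum_le_of_sum_le hW0 fun A => ?_
    calc ∑ n ∈ A, W n ≤ ∑ n ∈ B ∪ A, W n :=
          Finset.sum_le_sum_of_subset_of_nonneg Finset.subset_union_right fun n _ _ => hW0 n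
      _ = ∑ n ∈ B, W n + ∑ n ∈ A \ B, W n := by
          rw [← Finset.union_sdiff_self_eq_union, Finset.sum_union Finset.disjoint_sdiff]
      _ ≤ ∑ n ∈ B, W n + ∑ n ∈ A \ B, C₁ * F n * y ^ (-(3 / 4 - δ)) := by
          gcongr with n hn
          exact hout n (Finset.mem_sdiff.1 hn).2
      _ ≤ _ := by
          rw [← Finset.sum_mul, ← Finset.mul_sum]
          gcongr
          exact hFs.sum_le_tsum _ fun n _ => hF0 n
  have hlower : ∑ n ∈ B, W n ≤ ∑' n, W n := hWs.sum_le_tsum _ fun n _ => hW0 n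
  rw [abs_sub_comm, abs_of_nonneg (by linarith)]
  linarith

theorem signedRootSum_compl (t : Finset ι) (n : ι → ℕ) :
    signedRootSum tᶜ n = -signedRootSum t n := by
  rw [signedRootSum, signedRootSum, ← Finset.sum_neg_distrib]
  refine Finset.sum_congr rfl fun j _ => ?_
  by_cases hj : j ∈ t <;> simp [hj]

theorem vanishingTuples_compl (t : Finset ι) : vanishingTuples tᶜ = vanishingTuples t := by
  ext n
  simp [vanishingTuples, signedRootSum_compl]

theorem vanishingTuples_empty [Nonempty ι] : vanishingTuples (∅ : Finset ι) = ∅ := by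
  refine Set.eq_empty_of_forall_notMem fun n hn => ?_
  have h : signedRootSum ∅ n < 0 := by
    rw [signedRootSum]
    refine Finset.sum_neg (fun j _ => ?_) Finset.univ_nonempty
    have : (0 : ℝ) < n j := by exact_mod_cast hn.1 j
    simpa using Real.rpow_pos_of_pos this _
  exact h.ne hn.2

theorem tsum_vanishingTuples_congr_card (c : ℕ → ℝ) {t t' : Finset ι} (h : #t = #t') :
    ∑' n, (vanishingTuples t).indicator (tupleWeight c) n =
      ∑' n, (vanishingTuples t').indicator (tupleWeight c) n := by
  obtain ⟨σ, hσ⟩ := Equiv.Perm.exists_map_finset_eq t t' h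
  have hmem : ∀ j, σ j ∈ t' ↔ j ∈ t := fun j => by rw [← hσ]; simp
  rw [← (Equiv.arrowCongr σ (Equiv.refl ℕ)).tsum_eq
    ((vanishingTuples t').indicator (tupleWeight c))]
  refine tsum_congr fun n => ?_
  have happ : ∀ j, (Equiv.arrowCongr σ (Equiv.refl ℕ)) n (σ j) = n j := fun j => by simp
  set n' := (Equiv.arrowCongr σ (Equiv.refl ℕ)) n
  have hs : signedRootSum t' n' = signedRootSum t n := by
    rw [signedRootSum, signedRootSum, ← Equiv.sum_comp σ]
    exact Finset.sum_congr rfl fun j _ => by rw [happ]; simp only [hmem]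
  have hw : tupleWeight c n' = tupleWeight c n := by
    rw [tupleWeight, tupleWeight, ← Equiv.prod_comp σ, ← Equiv.prod_comp σ (fun j => (n' j : ℝ))]
    simp only [happ]
  have hp : (∀ j, 0 < n' j) ↔ ∀ j, 0 < n j :=
    ⟨fun H j => happ j ▸ H (σ j), fun H j => by
      obtain ⟨i, rfl⟩ := σ.surjective j
      rw [happ]; exact H i⟩
  have hZ : n' ∈ vanishingTuples t' ↔ n ∈ vanishingTuples t := by
    simp only [vanishingTuples, Set.mem_ofPred_eq, hs, hp]
  by_cases hn : n ∈ vanishingTuples t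
  · rw [Set.indicator_of_mem hn, Set.indicator_of_mem (hZ.2 hn), hw]
  · rw [Set.indicator_of_notMem hn, Set.indicator_of_notMem fun h => hn (hZ.1 h)]

end Weights

theorem sklRS_eq_tsum (c : ℕ → ℝ) {k l : ℕ} (hl : l ≤ k) (t : Finset (Fin k)) (ht : #t = l) :
    sklRS c k l = ∑' n, (vanishingTuples t).indicator (tupleWeight c) n := by
  have hcard : #(Finset.univ.filter fun j : Fin k => (j : ℕ) < l) = l := by
    rw [Fin.card_filter_val_lt, min_eq_right hl]
  rw [tsum_vanishingTuples_congr_card c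
    (ht.trans hcard.symm : #t = #(Finset.univ.filter fun j : Fin k => (j : ℕ) < l)),
    ← _root_.tsum_subtype]
  have hset : ∀ n : Fin k → ℕ, signedRootSum (Finset.univ.filter fun j : Fin k => (j : ℕ) < l) n
      = ∑ j ∈ Finset.univ.filter (fun j : Fin k => (j : ℕ) < l), ((n j : ℝ)) ^ ((1 : ℝ) / 4) -
        ∑ j ∈ Finset.univ.filter (fun j : Fin k => l ≤ (j : ℕ)), ((n j : ℝ)) ^ ((1 : ℝ) / 4) := by
    intro n
    rw [signedRootSum, Finset.sum_filter, Finset.sum_filter, ← Finset.sum_sub_distrib]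
    refine Finset.sum_congr rfl fun j _ => ?_
    by_cases hj : (j : ℕ) < l
    · simp [hj, not_le.2 hj]
    · simp [hj, not_lt.1 hj]
  have hZ : {n : Fin k → ℕ | (∀ j, 0 < n j) ∧
      ∑ j ∈ Finset.univ.filter (fun j : Fin k => (j : ℕ) < l), ((n j : ℝ)) ^ ((1 : ℝ) / 4) =
        ∑ j ∈ Finset.univ.filter (fun j : Fin k => l ≤ (j : ℕ)), ((n j : ℝ)) ^ ((1 : ℝ) / 4)}
      = vanishingTuples (Finset.univ.filter fun j : Fin k => (j : ℕ) < l) := by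
    ext n
    simp only [vanishingTuples, Set.mem_ofPred_eq, hset, sub_eq_zero]
  exact tsum_congr_set_coe (tupleWeight c) hZ

theorem sklRS_symm (c : ℕ → ℝ) {k l : ℕ} (hl : l ≤ k) : sklRS c k (k - l) = sklRS c k l := by
  obtain ⟨t, -, ht⟩ := Finset.exists_subset_card_eq
    (s := (Finset.univ : Finset (Fin k))) (n := l) (by simpa using hl)
  rw [sklRS_eq_tsum c hl t ht, sklRS_eq_tsum c (Nat.sub_le k l) tᶜ
    (by rw [Finset.card_compl, ht, Fintype.card_fin]), vanishingTuples_compl]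

theorem sklRS_zero (c : ℕ → ℝ) {k : ℕ} (hk : 0 < k) : sklRS c k 0 = 0 := by
  have : Nonempty (Fin k) := ⟨⟨0, hk⟩⟩
  rw [sklRS_eq_tsum c (Nat.zero_le k) ∅ rfl, vanishingTuples_empty]
  simp

theorem sum_cos_mul_tsum_eq (c : ℕ → ℝ) {k : ℕ} (hk : k = 3 ∨ k = 4 ∨ k = 5) :
    ∑ t : Finset (Fin k), Real.cos (π / 4 * (2 * #t - k)) *
      ∑' n, (vanishingTuples t).indicator (tupleWeight c) n = 2 * BkRS c k := by
  have h1 : ∑ t : Finset (Fin k), Real.cos (π / 4 * (2 * #t - k)) *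
      ∑' n, (vanishingTuples t).indicator (tupleWeight c) n
      = ∑ t : Finset (Fin k), Real.cos (π / 4 * (2 * (#t : ℕ) - k)) * sklRS c k #t := by
    refine Finset.sum_congr rfl fun t _ => ?_
    rw [sklRS_eq_tsum c (by simpa using Finset.card_le_univ t) t rfl]
  rw [h1, ← Finset.powerset_univ, Finset.sum_powerset_apply_card
    (fun l => Real.cos (π / 4 * (2 * (l : ℕ) - k)) * sklRS c k l), Finset.card_univ,
    Fintype.card_fin, BkRS]
  have hcos : ∀ x : ℝ, Real.cos (π / 4 * (2 * x - k)) = Real.cos (π * (k - 2 * x) / 4) := by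
    intro x
    rw [← Real.cos_neg]; congr 1; ring
  simp only [hcos]
  have hneg : ∀ x y : ℝ, x + y = k → Real.cos (π * (k - 2 * x) / 4)
      = Real.cos (π * (k - 2 * y) / 4) := by
    rintro x y h
    rw [← Real.cos_neg]; congr 1; rw [← h]; ring
  have hk0 : sklRS c k k = 0 := by
    have := sklRS_symm c (Nat.zero_le k)
    rw [Nat.sub_zero] at this
    rw [this, sklRS_zero c (by omega)]
  have h0 := sklRS_zero c (k := k) (by omega)
  have hs1 := sklRS_symm c (k := k) (l := 1) (by omega)
  have hs2 := sklRS_symm c (k := k) (l := 2) (by omega)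
  rcases hk with rfl | rfl | rfl
  · have e1 := hneg 2 1 (by norm_num)
    simp only [Finset.sum_range_succ, Finset.sum_range_zero, Nat.reduceSub] at *
    rw [show Finset.Icc 1 2 = {1, 2} by rfl]
    simp [Nat.choose, h0, hk0, hs1] at *
    rw [e1]; ring
  · have e1 := hneg 3 1 (by norm_num)
    simp only [Finset.sum_range_succ, Finset.sum_range_zero, Nat.reduceSub] at *
    rw [show Finset.Icc 1 3 = {1, 2, 3} by rfl]
    simp [Nat.choose, h0, hk0, hs1] at *
    rw [e1]; ring
  · have e1 := hneg 4 1 (by norm_num)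
    have e2 := hneg 3 2 (by norm_num)
    simp only [Finset.sum_range_succ, Finset.sum_range_zero, Nat.reduceSub] at *
    rw [show Finset.Icc 1 4 = {1, 2, 3, 4} by rfl]
    simp [Nat.choose, h0, hk0, hs1, hs2] at *
    rw [e1, e2]; ring

theorem prod_cos_eq_sum {ι : Type*} [Fintype ι] [DecidableEq ι] (θ : ι → ℝ) :
    ∏ j, Real.cos (θ j) = (1 / 2 ^ Fintype.card ι) *
      ∑ t : Finset ι, Real.cos (∑ j, ((if j ∈ t then 1 else -1 : ℤ) : ℝ) * θ j) := by
  have h1 : ((∏ j, Real.cos (θ j) : ℝ) : ℂ) = ((1 / 2 ^ Fintype.card ι : ℝ) : ℂ) *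
      ∑ t : Finset ι, Complex.exp
        (((∑ j, ((if j ∈ t then 1 else -1 : ℤ) : ℝ) * θ j : ℝ) : ℂ) * Complex.I) := by
    have h2 : ∀ j, ((Real.cos (θ j) : ℝ) : ℂ)
        = (1 / 2) * (Complex.exp (θ j * Complex.I) + Complex.exp (-θ j * Complex.I)) := by
      intro j
      rw [Complex.ofReal_cos, Complex.cos]; ring
    rw [Complex.ofReal_prod, Finset.prod_congr rfl fun j _ => h2 j, Finset.prod_mul_distrib,
      Finset.prod_const, Finset.card_univ, Fintype.prod_add]
    congr 1
    · push_cast; rw [div_pow, one_pow]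
    · refine Finset.sum_congr rfl fun t _ => ?_
      rw [← Complex.exp_sum, ← Complex.exp_sum, ← Complex.exp_add]
      congr 1
      rw [Complex.ofReal_sum, Finset.sum_mul, ← Finset.sum_add_sum_compl t]
      congr 1
      · exact Finset.sum_congr rfl fun j hj => by simp [hj]
      · refine Finset.sum_congr rfl fun j hj => ?_
        rw [Finset.mem_compl] at hj
        simp [hj]
  have h3 := congrArg Complex.re h1
  rw [Complex.ofReal_re, Complex.re_ofReal_mul, Complex.re_sum] at h3
  rw [h3]
  simp only [Complex.exp_ofReal_mul_I_re]

/-- First-derivative test for the phase `β x^{1/4}`. -/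
theorem abs_integral_rpow_mul_cos_le {p : ℝ} (hp : 1 / 4 ≤ p) {T : ℝ} (hT : 0 < T) {β : ℝ}
    (hβ : β ≠ 0) (φ : ℝ) :
    |∫ x in T..(2 * T), x ^ p * Real.cos (β * x ^ ((1 : ℝ) / 4) + φ)| ≤
      4 * (p + 3) * 2 ^ (p + 3 / 4) * T ^ (p + 3 / 4) / |β| := by
  set u : ℝ → ℝ := fun x => (4 / β) * x ^ (p + 3 / 4) with hu
  set v : ℝ → ℝ := fun x => Real.sin (β * x ^ ((1 : ℝ) / 4) + φ) with hv
  set u' : ℝ → ℝ := fun x => (4 / β) * ((p + 3 / 4) * x ^ (p - 1 / 4)) with hu'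
  set v' : ℝ → ℝ := fun x => Real.cos (β * x ^ ((1 : ℝ) / 4) + φ) *
    (β * ((1 / 4) * x ^ (-(3 : ℝ) / 4))) with hv'
  have hle : T ≤ 2 * T := by linarith
  have hpos : ∀ x ∈ Set.uIcc T (2 * T), 0 < x := fun x hx => by
    rw [Set.uIcc_of_le hle] at hx; linarith [hx.1]
  have hcr : ∀ e : ℝ, ContinuousOn (fun x : ℝ => x ^ e) (Set.uIcc T (2 * T)) := fun e =>
    continuousOn_id.rpow_const fun x hx => Or.inl (hpos x hx).ne'
  have hud : ∀ x ∈ Set.uIcc T (2 * T), HasDerivAt u (u' x) x := by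
    intro x hx
    have := (Real.hasDerivAt_rpow_const (x := x) (p := p + 3 / 4) (Or.inl (hpos x hx).ne'))
    have h2 := this.const_mul (4 / β)
    rwa [show p + 3 / 4 - 1 = p - 1 / 4 by ring] at h2
  have hvd : ∀ x ∈ Set.uIcc T (2 * T), HasDerivAt v (v' x) x := by
    intro x hx
    have := (Real.hasDerivAt_rpow_const (x := x) (p := (1 : ℝ) / 4) (Or.inl (hpos x hx).ne'))
    have h2 := ((this.const_mul β).add_const φ).sin
    rwa [show (1 : ℝ) / 4 - 1 = -(3 : ℝ) / 4 by ring] at h2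
  have hcos : ContinuousOn (fun x : ℝ => Real.cos (β * x ^ ((1 : ℝ) / 4) + φ))
      (Set.uIcc T (2 * T)) :=
    Real.continuous_cos.comp_continuousOn ((continuousOn_const.mul (hcr _)).add continuousOn_const)
  have hu'i : IntervalIntegrable u' MeasureTheory.volume T (2 * T) :=
    (continuousOn_const.mul (continuousOn_const.mul (hcr _))).intervalIntegrable
  have hv'i : IntervalIntegrable v' MeasureTheory.volume T (2 * T) :=
    (hcos.mul (continuousOn_const.mul (continuousOn_const.mul (hcr _)))).intervalIntegrable
  have hparts := intervalIntegral.integral_mul_deriv_eq_deriv_mul hud hvd hu'i hv'i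
  have hint : ∫ x in T..(2 * T), x ^ p * Real.cos (β * x ^ ((1 : ℝ) / 4) + φ)
      = ∫ x in T..(2 * T), u x * v' x := by
    refine intervalIntegral.integral_congr fun x hx => ?_
    have hx0 := hpos x hx
    simp only [hu, hv']
    have : x ^ p = x ^ (p + 3 / 4) * x ^ (-(3 : ℝ) / 4) := by
      rw [← Real.rpow_add hx0]; congr 1; ring
    rw [this]; field_simp
  rw [hint, hparts]
  have hb0 : 0 < |β| := abs_pos.2 hβ
  set P := (2 * T) ^ (p + 3 / 4) with hP
  have hP0 : 0 ≤ P := by positivity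
  have hsin : ∀ x, |v x| ≤ 1 := fun x => Real.abs_sin_le_one _
  have hux : ∀ x, 0 < x → x ≤ 2 * T → |u x| ≤ 4 / |β| * P := by
    intro x hx0 hx
    simp only [hu]
    rw [abs_mul, abs_div, abs_of_pos (by norm_num : (0 : ℝ) < 4),
      abs_of_nonneg (by positivity : 0 ≤ x ^ (p + 3 / 4))]
    exact mul_le_mul_of_nonneg_left (Real.rpow_le_rpow hx0.le hx (by linarith)) (by positivity)
  have hbd : ∀ x, 0 < x → x ≤ 2 * T → |u x * v x| ≤ 4 / |β| * P := fun x hx0 hx => by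
    rw [abs_mul]
    exact (mul_le_of_le_one_right (abs_nonneg _) (hsin x)).trans (hux x hx0 hx)
  have hI : |∫ x in T..(2 * T), u' x * v x| ≤ 4 / |β| * (p + 3 / 4) * P := by
    have h := intervalIntegral.norm_integral_le_of_norm_le_const (a := T) (b := 2 * T)
      (f := fun x => u' x * v x) (C := 4 / |β| * ((p + 3 / 4) * (2 * T) ^ (p - 1 / 4))) ?_
    · rw [Real.norm_eq_abs, show 2 * T - T = T by ring, abs_of_pos hT] at h
      refine h.trans ?_
      have e : P = (2 * T) ^ (p - 1 / 4) * (2 * T) := by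
        rw [hP, ← Real.rpow_add_one (by positivity)]; congr 1; ring
      rw [e]
      have : 0 ≤ 4 / |β| * ((p + 3 / 4) * (2 * T) ^ (p - 1 / 4)) :=
        mul_nonneg (by positivity) (mul_nonneg (by linarith) (by positivity))
      nlinarith
    · intro x hx
      rw [Set.uIoc_of_le hle] at hx
      have hx0 : 0 < x := hT.trans hx.1
      rw [Real.norm_eq_abs, abs_mul]
      refine (mul_le_of_le_one_right (abs_nonneg _) (hsin x)).trans ?_
      have h2 : 0 ≤ p + 3 / 4 := by linarith
      have h3 : 0 ≤ (p + 3 / 4) * x ^ (p - 1 / 4) := mul_nonneg h2 (by positivity)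
      simp only [hu']
      rw [abs_mul, abs_div, abs_of_pos (by norm_num : (0 : ℝ) < 4), abs_of_nonneg h3]
      have h1 : x ^ (p - 1 / 4) ≤ (2 * T) ^ (p - 1 / 4) :=
        Real.rpow_le_rpow hx0.le hx.2 (by linarith)
      gcongr
  calc |u (2 * T) * v (2 * T) - u T * v T - ∫ x in T..(2 * T), u' x * v x|
      ≤ |u (2 * T) * v (2 * T)| + |u T * v T| + |∫ x in T..(2 * T), u' x * v x| := by
        refine (abs_sub _ _).trans (add_le_add_left (abs_sub _ _) _)
    _ ≤ 4 / |β| * P + 4 / |β| * P + 4 / |β| * (p + 3 / 4) * P :=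
        add_le_add (add_le_add (hbd _ (by linarith) le_rfl) (hbd _ hT hle)) hI
    _ = 4 * (p + 11 / 4) * P / |β| := by ring
    _ ≤ 4 * (p + 3) * P / |β| := by gcongr; norm_num
    _ = _ := by rw [hP, Real.mul_rpow (by norm_num) hT.le]; ring

theorem sum_rpow_neg_seven_eighths_le (N : ℕ) :
    ∑ n ∈ Finset.Icc 1 N, (n : ℝ) ^ (-(7 : ℝ) / 8) ≤ 8 * (N : ℝ) ^ ((1 : ℝ) / 8) := by
  induction N with
  | zero => simp
  | succ N ih =>
    rw [Finset.sum_Icc_succ_top (by omega)]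
    have hx : (0 : ℝ) < ((N + 1 : ℕ) : ℝ) := by positivity
    set u := ((N + 1 : ℕ) : ℝ) ^ ((1 : ℝ) / 8) with hu
    set v := (N : ℝ) ^ ((1 : ℝ) / 8) with hv
    have hu0 : 0 < u := Real.rpow_pos_of_pos hx _
    have hv0 : 0 ≤ v := by positivity
    have hvu : v ≤ u := Real.rpow_le_rpow (by positivity) (by push_cast; linarith) (by norm_num)
    have hu8 : u ^ 8 = (N : ℝ) + 1 := by
      rw [hu, ← Real.rpow_natCast, ← Real.rpow_mul hx.le]; norm_num
    have hv8 : v ^ 8 = (N : ℝ) := by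
      rw [hv, ← Real.rpow_natCast, ← Real.rpow_mul (by positivity)]; norm_num
    have hw : ((N + 1 : ℕ) : ℝ) ^ (-(7 : ℝ) / 8) = 1 / u ^ 7 := by
      rw [hu, ← Real.rpow_natCast, ← Real.rpow_mul hx.le, one_div, ← Real.rpow_neg hx.le]
      norm_num
    have key : 1 / u ^ 7 ≤ 8 * (u - v) := by
      rw [div_le_iff₀ (by positivity)]
      have h1 : u ^ 8 - v ^ 8 = 1 := by rw [hu8, hv8]; ring
      have hgeom : u ^ 8 - v ^ 8 = (∑ i ∈ Finset.range 8, u ^ i * v ^ (8 - 1 - i)) * (u - v) :=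
        (Commute.geom_sum₂_mul (Commute.all u v) 8).symm
      have hle : ∑ i ∈ Finset.range 8, u ^ i * v ^ (8 - 1 - i) ≤ 8 * u ^ 7 := by
        calc _ ≤ ∑ _i ∈ Finset.range 8, u ^ 7 := by
              refine Finset.sum_le_sum fun i hi => ?_
              have hi' := Finset.mem_range.1 hi
              calc u ^ i * v ^ (8 - 1 - i) ≤ u ^ i * u ^ (8 - 1 - i) := by gcongr
                _ = u ^ 7 := by rw [← pow_add]; congr 1; omega
          _ = _ := by simp
      have := mul_le_mul_of_nonneg_right hle (sub_nonneg.2 hvu)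
      linarith
    rw [hw]
    linarith

theorem fourthRoot_spacing {p q N : ℕ} (hpq : p < q) (hq : q ≤ N) :
    (N : ℝ) ^ (-(3 : ℝ) / 4) / 4 ≤ (q : ℝ) ^ ((1 : ℝ) / 4) - (p : ℝ) ^ ((1 : ℝ) / 4) := by
  have hN : (0 : ℝ) < N := by exact_mod_cast (by omega : 0 < N)
  set u := (q : ℝ) ^ ((1 : ℝ) / 4) with hu
  set v := (p : ℝ) ^ ((1 : ℝ) / 4) with hv
  set w := (N : ℝ) ^ ((1 : ℝ) / 4) with hw
  have hpow : ∀ x : ℝ, 0 ≤ x → (x ^ ((1 : ℝ) / 4)) ^ 4 = x := fun x hx => by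
    rw [← Real.rpow_natCast, ← Real.rpow_mul hx]; norm_num
  have hu4 : u ^ 4 = q := hpow _ (by positivity)
  have hv4 : v ^ 4 = p := hpow _ (by positivity)
  have hu0 : 0 ≤ u := by positivity
  have hv0 : 0 ≤ v := by positivity
  have hw0 : 0 < w := by positivity
  have hvu : v ≤ u := Real.rpow_le_rpow (by positivity) (by exact_mod_cast hpq.le) (by norm_num)
  have huw : u ≤ w := Real.rpow_le_rpow (by positivity) (by exact_mod_cast hq) (by norm_num)
  have hw3 : (N : ℝ) ^ (-(3 : ℝ) / 4) = 1 / w ^ 3 := by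
    rw [hw, ← Real.rpow_natCast, ← Real.rpow_mul hN.le, one_div, ← Real.rpow_neg hN.le]
    norm_num
  have hdiff : 1 ≤ u ^ 4 - v ^ 4 := by
    rw [hu4, hv4]
    have : (p : ℝ) + 1 ≤ q := by exact_mod_cast hpq
    linarith
  rw [hw3, div_div, div_le_iff₀ (by positivity)]
  have h1 : u ^ 3 + u ^ 2 * v + u * v ^ 2 + v ^ 3 ≤ w ^ 3 + w ^ 2 * w + w * w ^ 2 + w ^ 3 := by
    have hvw := hvu.trans huw
    gcongr
  calc 1 ≤ u ^ 4 - v ^ 4 := hdiff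
    _ = (u - v) * (u ^ 3 + u ^ 2 * v + u * v ^ 2 + v ^ 3) := by ring
    _ ≤ (u - v) * (w ^ 3 + w ^ 2 * w + w * w ^ 2 + w ^ 3) :=
        mul_le_mul_of_nonneg_left h1 (sub_nonneg.2 hvu)
    _ = (u - v) * (w ^ 3 * 4) := by ring

section SmallSums

variable {ι : Type*} [Fintype ι] [DecidableEq ι]

theorem rpow_div_abs_signedRootSum_le (hι : 3 ≤ Fintype.card ι) {t : Finset ι} {n : ι → ℕ} {N : ℕ}
    (hn : ∀ j, 0 < n j) {a : ι} (ha : ∀ j, n j ≤ n a) (haN : n a ≤ N)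
    (h0 : signedRootSum t n ≠ 0) :
    (n a : ℝ) ^ (-(7 : ℝ) / 8) / |signedRootSum t n| ≤
      (Fintype.card ι : ℝ) ^ (4 ^ (Fintype.card ι - 1) - 1) *
        (N : ℝ) ^ ((4 : ℝ) ^ (Fintype.card ι - 2) - 9 / 8) := by
  have h1 := one_le_signed_fourthRoot_sum (fun j => if j ∈ t then 1 else -1)
    (fun j => by split_ifs <;> simp) n hn a ha h0
  change 1 ≤ |signedRootSum t n| ^ 4 * _ at h1
  set k := Fintype.card ι
  set α := |signedRootSum t n|
  have hα : 0 < α := abs_pos.2 h0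
  have hx : (0 : ℝ) < n a := by exact_mod_cast hn a
  obtain ⟨m, hm⟩ : ∃ m, k = m + 3 := ⟨k - 3, by omega⟩
  have hE : (((4 ^ (k - 1) - 1 : ℕ) : ℝ)) = 4 * (4 : ℝ) ^ (k - 2) - 1 := by
    rw [Nat.cast_sub (Nat.one_le_pow _ _ (by norm_num)), hm]
    push_cast
    ring
  set E := 4 ^ (k - 1) - 1
  have h4 : (4 : ℝ) ≤ (4 : ℝ) ^ (k - 2) := le_self_pow₀ (by norm_num) (by omega)
  have hz : ((k : ℝ) ^ E * (n a : ℝ) ^ ((E : ℝ) / 4)) ^ 4 = ((k : ℝ) ^ 4 * n a) ^ E := by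
    rw [mul_pow, mul_pow, ← pow_mul, ← pow_mul, mul_comm E 4, ← Real.rpow_natCast (_ ^ _) 4,
      ← Real.rpow_mul hx.le, ← Real.rpow_natCast (n a : ℝ) E]
    norm_num
  rw [← hz, ← mul_pow] at h1
  have h2 : 1 ≤ α * ((k : ℝ) ^ E * (n a : ℝ) ^ ((E : ℝ) / 4)) := by
    by_contra! h
    exact absurd h1 (not_le.2 (pow_lt_one₀ (by positivity) h (by norm_num)))
  rw [div_le_iff₀ hα]
  calc (n a : ℝ) ^ (-(7 : ℝ) / 8)
      ≤ (n a : ℝ) ^ (-(7 : ℝ) / 8) * (α * ((k : ℝ) ^ E * (n a : ℝ) ^ ((E : ℝ) / 4))) :=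
        le_mul_of_one_le_right (by positivity) h2
    _ = (k : ℝ) ^ E * (n a : ℝ) ^ ((4 : ℝ) ^ (k - 2) - 9 / 8) * α := by
        rw [show (4 : ℝ) ^ (k - 2) - 9 / 8 = -7 / 8 + (E : ℝ) / 4 by rw [hE]; ring,
          Real.rpow_add hx]
        ring
    _ ≤ _ := by
        gcongr
        linarith

/-- A tuple with a small signed fourth-root sum is determined by all but one of its entries. -/
theorem eq_of_update_eq_of_abs_signedRootSum_lt (t : Finset ι) (a : ι) {N : ℕ} {n n' : ι → ℕ}
    (hn : ∀ j, n j ≤ N) (hn' : ∀ j, n' j ≤ N)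
    (h : |signedRootSum t n| < (N : ℝ) ^ (-(3 : ℝ) / 4) / 8)
    (h' : |signedRootSum t n'| < (N : ℝ) ^ (-(3 : ℝ) / 4) / 8)
    (heq : Function.update n a 1 = Function.update n' a 1) : n = n' := by
  have hoff : ∀ j, j ≠ a → n j = n' j := fun j hj => by
    simpa [hj] using congrFun heq j
  have hdiff : signedRootSum t n - signedRootSum t n' =
      ((if a ∈ t then 1 else -1 : ℤ) : ℝ) *
        ((n a : ℝ) ^ ((1 : ℝ) / 4) - (n' a : ℝ) ^ ((1 : ℝ) / 4)) := by
    rw [signedRootSum, signedRootSum, ← Finset.sum_sub_distrib,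
      Finset.sum_eq_single a (fun j _ hj => by rw [hoff j hj, sub_self])
        (fun hj => absurd (Finset.mem_univ a) hj), mul_sub]
  have habs : |(n a : ℝ) ^ ((1 : ℝ) / 4) - (n' a : ℝ) ^ ((1 : ℝ) / 4)| <
      (N : ℝ) ^ (-(3 : ℝ) / 4) / 4 := by
    have h1 : |signedRootSum t n - signedRootSum t n'| =
        |(n a : ℝ) ^ ((1 : ℝ) / 4) - (n' a : ℝ) ^ ((1 : ℝ) / 4)| := by
      rw [hdiff, abs_mul]
      split_ifs <;> simp
    rw [← h1]
    linarith [abs_sub (signedRootSum t n) (signedRootSum t n')]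
  have ha : n a = n' a := by
    rcases lt_trichotomy (n a) (n' a) with hlt | he | hlt
    · have := fourthRoot_spacing hlt (hn' a)
      rw [abs_sub_comm] at habs
      linarith [(abs_lt.1 habs).2]
    · exact he
    · have := fourthRoot_spacing hlt (hn a)
      linarith [(abs_lt.1 habs).2]
  funext j
  by_cases hj : j = a
  · rw [hj, ha]
  · exact hoff j hj

theorem sum_piFinset_prod_rpow_le (N : ℕ) :
    ∑ n ∈ Fintype.piFinset fun _ : ι => Finset.Icc 1 N, ∏ j, (n j : ℝ) ^ (-(7 : ℝ) / 8) ≤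
      (8 * (N : ℝ) ^ ((1 : ℝ) / 8)) ^ Fintype.card ι := by
  rw [← Finset.prod_univ_sum (fun _ : ι => Finset.Icc 1 N)
    (fun _ m => (m : ℝ) ^ (-(7 : ℝ) / 8)), Finset.prod_const, Finset.card_univ]
  exact pow_le_pow_left₀ (Finset.sum_nonneg fun _ _ => by positivity)
    (sum_rpow_neg_seven_eighths_le N) _

theorem sum_prod_erase_rpow_le (t : Finset ι) (a : ι) (N : ℕ) {G : Finset (ι → ℕ)}
    (hG : ∀ n ∈ G, (∀ j, n j ∈ Finset.Icc 1 N) ∧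
      |signedRootSum t n| < (N : ℝ) ^ (-(3 : ℝ) / 4) / 8) :
    ∑ n ∈ G, ∏ j ∈ Finset.univ.erase a, (n j : ℝ) ^ (-(7 : ℝ) / 8) ≤
      (8 * (N : ℝ) ^ ((1 : ℝ) / 8)) ^ (Fintype.card ι - 1) := by
  set B : Finset (ι → ℕ) := Fintype.piFinset fun j => if j = a then {1} else Finset.Icc 1 N
  have hinj : Set.InjOn (fun n : ι → ℕ => Function.update n a 1) G := fun n hn n' hn' heq =>
    eq_of_update_eq_of_abs_signedRootSum_lt t a (fun j => (Finset.mem_Icc.1 ((hG n hn).1 j)).2)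
      (fun j => (Finset.mem_Icc.1 ((hG n' hn').1 j)).2) (hG n hn).2 (hG n' hn').2 heq
  have hsub : G.image (fun n : ι → ℕ => Function.update n a 1) ⊆ B := by
    intro m hm
    obtain ⟨n, hn, rfl⟩ := Finset.mem_image.1 hm
    refine Fintype.mem_piFinset.2 fun j => ?_
    by_cases hj : j = a
    · subst hj; simp
    · simpa [hj] using (hG n hn).1 j
  calc ∑ n ∈ G, ∏ j ∈ Finset.univ.erase a, (n j : ℝ) ^ (-(7 : ℝ) / 8)
      = ∑ n ∈ G, ∏ j, (Function.update n a 1 j : ℝ) ^ (-(7 : ℝ) / 8) := by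
        refine Finset.sum_congr rfl fun n _ => ?_
        rw [← Finset.mul_prod_erase _ _ (Finset.mem_univ a)]
        simp only [Function.update_self, Nat.cast_one, Real.one_rpow, one_mul]
        exact Finset.prod_congr rfl fun j hj => by
          rw [Function.update_of_ne (Finset.ne_of_mem_erase hj)]
    _ = ∑ m ∈ G.image (fun n : ι → ℕ => Function.update n a 1),
          ∏ j, (m j : ℝ) ^ (-(7 : ℝ) / 8) :=
        (Finset.sum_image (f := fun m : ι → ℕ => ∏ j, (m j : ℝ) ^ (-(7 : ℝ) / 8)) hinj).symm
    _ ≤ ∑ m ∈ B, ∏ j, (m j : ℝ) ^ (-(7 : ℝ) / 8) :=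
        Finset.sum_le_sum_of_subset_of_nonneg hsub fun _ _ _ =>
          Finset.prod_nonneg fun _ _ => by positivity
    _ = ∏ j ∈ Finset.univ.erase a, ∑ m ∈ Finset.Icc 1 N, (m : ℝ) ^ (-(7 : ℝ) / 8) := by
        rw [← Finset.prod_univ_sum (fun j => if j = a then {1} else Finset.Icc 1 N)
          (fun _ m => (m : ℝ) ^ (-(7 : ℝ) / 8)), ← Finset.mul_prod_erase _ _ (Finset.mem_univ a)]
        simp only [if_true, Finset.sum_singleton, Nat.cast_one, Real.one_rpow, one_mul]
        exact Finset.prod_congr rfl fun j hj => by rw [if_neg (Finset.ne_of_mem_erase hj)]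
    _ ≤ _ := by
        rw [Finset.prod_const, Finset.card_erase_of_mem (Finset.mem_univ a), Finset.card_univ]
        exact pow_le_pow_left₀ (Finset.sum_nonneg fun _ _ => by positivity)
          (sum_rpow_neg_seven_eighths_le N) _

theorem exists_sum_div_signedRootSum_le (hι : 3 ≤ Fintype.card ι) :
    ∃ C : ℝ, 0 ≤ C ∧ ∀ N : ℕ, 1 ≤ N → ∀ t : Finset ι,
      ∑ n ∈ (Fintype.piFinset fun _ : ι => Finset.Icc 1 N).filter (fun n => signedRootSum t n ≠ 0),
        (∏ j, (n j : ℝ) ^ (-(7 : ℝ) / 8)) / |signedRootSum t n| ≤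
      C * (N : ℝ) ^ ((4 : ℝ) ^ (Fintype.card ι - 2) - 5 / 4 + (Fintype.card ι : ℝ) / 8) := by
  set k := Fintype.card ι with hk
  set D : ℝ := (k : ℝ) ^ (4 ^ (k - 1) - 1)
  have hne : Nonempty ι := Fintype.card_pos_iff.1 (by omega)
  have h4 : (4 : ℝ) ≤ (4 : ℝ) ^ (k - 2) := le_self_pow₀ (by norm_num) (by omega)
  refine ⟨8 * 8 ^ k + k * (D * 8 ^ (k - 1)), by positivity, fun N hN t => ?_⟩
  have hNpos : (0 : ℝ) < N := by exact_mod_cast hN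
  have hN1 : (1 : ℝ) ≤ N := by exact_mod_cast hN
  set P : ℝ := (4 : ℝ) ^ (k - 2) - 9 / 8
  set box := Fintype.piFinset fun _ : ι => Finset.Icc 1 N
  set S := box.filter fun n => signedRootSum t n ≠ 0
  set small : (ι → ℕ) → Prop := fun n => |signedRootSum t n| < (N : ℝ) ^ (-(3 : ℝ) / 4) / 8
  have hbox : ∀ n ∈ S, ∀ j, n j ∈ Finset.Icc 1 N := fun n hn =>
    Fintype.mem_piFinset.1 (Finset.mem_filter.1 hn).1
  have hS0 : ∀ n ∈ S, 0 < |signedRootSum t n| := fun n hn =>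
    abs_pos.2 (Finset.mem_filter.1 hn).2
  have hprod : ∀ n : ι → ℕ, 0 ≤ ∏ j, (n j : ℝ) ^ (-(7 : ℝ) / 8) := fun n =>
    Finset.prod_nonneg fun _ _ => by positivity
  have hbig : ∑ n ∈ S.filter (fun n => ¬ small n),
      (∏ j, (n j : ℝ) ^ (-(7 : ℝ) / 8)) / |signedRootSum t n| ≤
      8 * 8 ^ k * (N : ℝ) ^ ((4 : ℝ) ^ (k - 2) - 5 / 4 + (k : ℝ) / 8) := by
    calc ∑ n ∈ S.filter (fun n => ¬ small n),
          (∏ j, (n j : ℝ) ^ (-(7 : ℝ) / 8)) / |signedRootSum t n|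
        ≤ ∑ n ∈ S.filter (fun n => ¬ small n),
          8 * (N : ℝ) ^ ((3 : ℝ) / 4) * ∏ j, (n j : ℝ) ^ (-(7 : ℝ) / 8) := by
          refine Finset.sum_le_sum fun n hn => ?_
          obtain ⟨hnS, hns⟩ := Finset.mem_filter.1 hn
          rw [div_le_iff₀ (hS0 n hnS), mul_right_comm]
          refine le_mul_of_one_le_left (hprod n) ?_
          calc (1 : ℝ) = 8 * (N : ℝ) ^ ((3 : ℝ) / 4) * ((N : ℝ) ^ (-(3 : ℝ) / 4) / 8) := by
                rw [neg_div, Real.rpow_neg hNpos.le]; field_simp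
            _ ≤ _ := by gcongr; exact not_lt.1 hns
      _ ≤ 8 * (N : ℝ) ^ ((3 : ℝ) / 4) * (8 * (N : ℝ) ^ ((1 : ℝ) / 8)) ^ k := by
          rw [← Finset.mul_sum]
          gcongr
          refine (Finset.sum_le_sum_of_subset_of_nonneg ((Finset.filter_subset _ _).trans
            (Finset.filter_subset _ _)) fun n _ _ => hprod n).trans (sum_piFinset_prod_rpow_le N)
      _ = 8 * 8 ^ k * (N : ℝ) ^ ((3 : ℝ) / 4 + (k : ℝ) / 8) := by
          rw [mul_pow, ← Real.rpow_natCast (_ ^ _) k, ← Real.rpow_mul hNpos.le,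
            Real.rpow_add hNpos, show (1 : ℝ) / 8 * k = k / 8 by ring]
          ring
      _ ≤ _ := by gcongr; linarith
  have hsmall : ∑ n ∈ S.filter small,
      (∏ j, (n j : ℝ) ^ (-(7 : ℝ) / 8)) / |signedRootSum t n| ≤
      k * (D * 8 ^ (k - 1)) * (N : ℝ) ^ ((4 : ℝ) ^ (k - 2) - 5 / 4 + (k : ℝ) / 8) := by
    classical
    calc ∑ n ∈ S.filter small, (∏ j, (n j : ℝ) ^ (-(7 : ℝ) / 8)) / |signedRootSum t n|
        ≤ ∑ n ∈ S.filter small, ∑ a : ι,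
            D * (N : ℝ) ^ P * ∏ j ∈ Finset.univ.erase a, (n j : ℝ) ^ (-(7 : ℝ) / 8) := by
          refine Finset.sum_le_sum fun n hn => ?_
          obtain ⟨hnS, -⟩ := Finset.mem_filter.1 hn
          obtain ⟨a, -, ha⟩ := Finset.exists_max_image Finset.univ n Finset.univ_nonempty
          refine le_trans ?_ (Finset.single_le_sum (fun a _ => mul_nonneg (by positivity)
            (Finset.prod_nonneg fun j _ => by positivity)) (Finset.mem_univ a))
          rw [← Finset.mul_prod_erase _ _ (Finset.mem_univ a), mul_div_right_comm]
          refine mul_le_mul_of_nonneg_right ?_ (Finset.prod_nonneg fun j _ => by positivity)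
          exact rpow_div_abs_signedRootSum_le hι (fun j => (Finset.mem_Icc.1 (hbox n hnS j)).1)
            (fun j => ha j (Finset.mem_univ j)) (Finset.mem_Icc.1 (hbox n hnS a)).2
            (Finset.mem_filter.1 hnS).2
      _ = ∑ a : ι, D * (N : ℝ) ^ P *
            ∑ n ∈ S.filter small, ∏ j ∈ Finset.univ.erase a, (n j : ℝ) ^ (-(7 : ℝ) / 8) := by
          rw [Finset.sum_comm]
          exact Finset.sum_congr rfl fun a _ => (Finset.mul_sum _ _ _).symm
      _ ≤ ∑ _a : ι, D * (N : ℝ) ^ P * (8 * (N : ℝ) ^ ((1 : ℝ) / 8)) ^ (k - 1) := by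
          refine Finset.sum_le_sum fun a _ => mul_le_mul_of_nonneg_left
            (sum_prod_erase_rpow_le t a N fun n hn => ?_) (by positivity)
          exact ⟨hbox n (Finset.mem_filter.1 hn).1, (Finset.mem_filter.1 hn).2⟩
      _ = _ := by
          rw [Finset.sum_const, Finset.card_univ, ← hk, nsmul_eq_mul, mul_pow,
            ← Real.rpow_natCast (_ ^ _) (k - 1), ← Real.rpow_mul hNpos.le,
            Nat.cast_sub (by omega : 1 ≤ k),
            show (4 : ℝ) ^ (k - 2) - 5 / 4 + (k : ℝ) / 8 = P + 1 / 8 * ((k : ℝ) - (1 : ℕ)) by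
              push_cast; ring, Real.rpow_add hNpos]
          ring
  rw [← Finset.sum_filter_add_sum_filter_not S small, add_mul]
  linarith

end SmallSums

section PowerMoment

theorem tupleWeight_le_rpow_mul {ι : Type*} [Fintype ι] {c : ℕ → ℝ} (hc0 : ∀ n, 0 ≤ c n) {K ε : ℝ} (hε : 0 ≤ ε)
    (hι : 0 < Fintype.card ι) (hK0 : 0 ≤ K)
    (hK : ∀ n : ℕ, 1 ≤ n → c n ≤ K * (n : ℝ) ^ (ε / Fintype.card ι)) {y : ℝ} (hy : 0 ≤ y)
    {n : ι → ℕ} (hn : ∀ j, n j ∈ Finset.Icc 1 ⌊y⌋₊) :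
    tupleWeight c n ≤ K ^ Fintype.card ι * y ^ ε * ∏ j, (n j : ℝ) ^ (-(7 : ℝ) / 8) := by
  have hpos : ∀ j, 0 < n j := fun j => (Finset.mem_Icc.1 (hn j)).1
  refine (tupleWeight_le hc0 hK n hpos).trans ?_
  rw [mul_assoc]
  refine mul_le_mul_of_nonneg_left ?_ (by positivity)
  have hyε : y ^ ε = ∏ _j : ι, y ^ (ε / Fintype.card ι) := by
    have : (Fintype.card ι : ℝ) ≠ 0 := by exact_mod_cast hι.ne'
    rw [Finset.prod_const, Finset.card_univ, ← Real.rpow_natCast, ← Real.rpow_mul hy,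
      div_mul_cancel₀ _ this]
  rw [hyε, ← Finset.prod_mul_distrib]
  refine Finset.prod_le_prod (fun j _ => by positivity) fun j _ => ?_
  have hj : (0 : ℝ) < n j := by exact_mod_cast hpos j
  rw [sub_eq_add_neg, Real.rpow_add hj, neg_div]
  gcongr
  exact (Nat.le_floor_iff hy).1 (Finset.mem_Icc.1 (hn j)).2

variable {ι : Type*} [Fintype ι] [DecidableEq ι]

/-- The tuples with nonvanishing phase contribute only to the error term. -/
theorem exists_oscillating_bound {c : ℕ → ℝ} (hc0 : ∀ n, 0 ≤ c n)
    (hc : ∀ ε : ℝ, 0 < ε → ∃ K : ℝ, 0 < K ∧ ∀ n : ℕ, 1 ≤ n → c n ≤ K * (n : ℝ) ^ ε)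
    (hι : 3 ≤ Fintype.card ι) {ε : ℝ} (hε : 0 < ε) {p : ℝ} (hp : 1 / 4 ≤ p) :
    ∃ C : ℝ, 0 ≤ C ∧ ∀ T y : ℝ, 0 < T → 1 ≤ y → ∀ (t : Finset ι) (φ : ℝ),
      |∑ n ∈ (Fintype.piFinset fun _ : ι => Finset.Icc 1 ⌊y⌋₊).filter
          (fun n => signedRootSum t n ≠ 0),
        tupleWeight c n * ∫ x in T..(2 * T),
          x ^ p * Real.cos (8 * π * signedRootSum t n * x ^ ((1 : ℝ) / 4) + φ)| ≤
      C * (y ^ ε * T ^ (p + 3 / 4) *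
        y ^ ((4 : ℝ) ^ (Fintype.card ι - 2) - 5 / 4 + (Fintype.card ι : ℝ) / 8)) := by
  have hk : (0 : ℝ) < Fintype.card ι := by exact_mod_cast (by omega : 0 < Fintype.card ι)
  obtain ⟨K, hK0, hK⟩ := hc (ε / Fintype.card ι) (div_pos hε hk)
  obtain ⟨C, hC0, hC⟩ := exists_sum_div_signedRootSum_le (ι := ι) hι
  set k := Fintype.card ι
  set A : ℝ := 4 * (p + 3) * 2 ^ (p + 3 / 4) / (8 * π)
  have hA : 0 ≤ A := by positivity
  have h4 : (4 : ℝ) ≤ (4 : ℝ) ^ (k - 2) := le_self_pow₀ (by norm_num) (by omega)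
  refine ⟨K ^ k * A * C, by positivity, fun T y hT hy t φ => ?_⟩
  have hy0 : 0 ≤ y := by linarith
  set S := (Fintype.piFinset fun _ : ι => Finset.Icc 1 ⌊y⌋₊).filter
    (fun n => signedRootSum t n ≠ 0)
  set Q : ℝ := (4 : ℝ) ^ (k - 2) - 5 / 4 + (k : ℝ) / 8
  have hQ : 0 ≤ Q := by
    have : (0 : ℝ) ≤ (k : ℝ) / 8 := by positivity
    simp only [Q]
    linarith
  calc _ ≤ ∑ n ∈ S, K ^ k * y ^ ε * (A * T ^ (p + 3 / 4)) *
          ((∏ j, (n j : ℝ) ^ (-(7 : ℝ) / 8)) / |signedRootSum t n|) := by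
        refine (Finset.abs_sum_le_sum_abs _ _).trans (Finset.sum_le_sum fun n hn => ?_)
        obtain ⟨hbox, h0⟩ := Finset.mem_filter.1 hn
        have hα : 0 < |signedRootSum t n| := abs_pos.2 h0
        rw [abs_mul, abs_of_nonneg (tupleWeight_nonneg hc0 n)]
        calc _ ≤ (K ^ k * y ^ ε * ∏ j, (n j : ℝ) ^ (-(7 : ℝ) / 8)) *
              (4 * (p + 3) * 2 ^ (p + 3 / 4) * T ^ (p + 3 / 4) / |8 * π * signedRootSum t n|) :=
              mul_le_mul
                (tupleWeight_le_rpow_mul hc0 hε.le (by omega) hK0.le hK hy0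
                  (Fintype.mem_piFinset.1 hbox))
                (abs_integral_rpow_mul_cos_le hp hT (by positivity) φ) (abs_nonneg _)
                (mul_nonneg (by positivity) (Finset.prod_nonneg fun _ _ => by positivity))
          _ = _ := by
              rw [abs_mul, abs_of_pos (by positivity : 0 < 8 * π)]
              simp only [A]
              field_simp
    _ ≤ K ^ k * y ^ ε * (A * T ^ (p + 3 / 4)) * (C * y ^ Q) := by
        rw [← Finset.mul_sum]
        refine mul_le_mul_of_nonneg_left ?_ (by positivity)
        refine (hC ⌊y⌋₊ (Nat.le_floor (by simpa using hy)) t).trans ?_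
        gcongr
        exact Nat.floor_le hy0
    _ = _ := by ring

theorem R1_pow_eq (c : ℕ → ℝ) (k : ℕ) {x : ℝ} (hx : 0 < x) (y : ℝ) :
    R1 c x y ^ k = 1 / (8 * π ^ 2) ^ k * ∑ t : Finset (Fin k),
      ∑ n ∈ Fintype.piFinset fun _ : Fin k => Finset.Icc 1 ⌊y⌋₊,
        tupleWeight c n * (x ^ ((9 * k : ℝ) / 8) *
          Real.cos (8 * π * signedRootSum t n * x ^ ((1 : ℝ) / 4) + -(π / 4 * (2 * #t - k)))) := by
  have hterm : ∀ n : Fin k → ℕ,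
      ∏ j, (c (n j) / (n j : ℝ) ^ ((7 : ℝ) / 8) *
        Real.cos (8 * π * ((n j : ℝ) * x) ^ ((1 : ℝ) / 4) - π / 4)) =
      tupleWeight c n * (1 / 2 ^ k * ∑ t : Finset (Fin k),
        Real.cos (8 * π * signedRootSum t n * x ^ ((1 : ℝ) / 4) + -(π / 4 * (2 * #t - k)))) := by
    intro n
    rw [Finset.prod_mul_distrib, Finset.prod_div_distrib,
      Real.finsetProd_rpow _ _ fun j _ => Nat.cast_nonneg _, prod_cos_eq_sum, Fintype.card_fin,
      tupleWeight]
    congr 3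
    funext t
    congr 1
    have hsign : ∑ j : Fin k, ((if j ∈ t then 1 else -1 : ℤ) : ℝ) = 2 * #t - k := by
      have h1 : ∀ j : Fin k, ((if j ∈ t then 1 else -1 : ℤ) : ℝ) =
          2 * (if j ∈ t then 1 else 0) - 1 := fun j => by split_ifs <;> norm_num
      simp only [h1, Finset.sum_sub_distrib, ← Finset.mul_sum, Finset.sum_ite_mem]
      simp
    rw [← hsign, signedRootSum, Finset.mul_sum, Finset.sum_mul, Finset.mul_sum,
      ← Finset.sum_neg_distrib, ← Finset.sum_add_distrib]
    refine Finset.sum_congr rfl fun j _ => ?_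
    rw [Real.mul_rpow (Nat.cast_nonneg _) hx.le]
    ring
  have hpow : (x ^ ((9 : ℝ) / 8)) ^ k = x ^ ((9 * k : ℝ) / 8) := by
    rw [← Real.rpow_natCast, ← Real.rpow_mul hx.le]
    ring_nf
  rw [R1, mul_pow, div_pow, hpow, Finset.sum_pow', Finset.sum_comm, Finset.mul_sum, Finset.mul_sum]
  refine Finset.sum_congr rfl fun n _ => ?_
  rw [hterm, ← Finset.mul_sum, ← Finset.mul_sum,
    show (8 * π ^ 2) ^ k = 2 ^ k * (4 * π ^ 2) ^ k by rw [← mul_pow]; ring]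
  generalize ∑ t : Finset (Fin k), Real.cos (_ : ℝ) = X
  field_simp

theorem integral_R1_pow (c : ℕ → ℝ) (k : ℕ) {T : ℝ} (hT : 0 < T) (y : ℝ) :
    ∫ x in T..(2 * T), R1 c x y ^ k = 1 / (8 * π ^ 2) ^ k * ∑ t : Finset (Fin k),
      ∑ n ∈ Fintype.piFinset fun _ : Fin k => Finset.Icc 1 ⌊y⌋₊,
        tupleWeight c n * ∫ x in T..(2 * T), x ^ ((9 * k : ℝ) / 8) *
          Real.cos (8 * π * signedRootSum t n * x ^ ((1 : ℝ) / 4) +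
            -(π / 4 * (2 * #t - k))) := by
  have hcont : ∀ (β φ : ℝ), Continuous fun x : ℝ =>
      x ^ ((9 * k : ℝ) / 8) * Real.cos (β * x ^ ((1 : ℝ) / 4) + φ) := fun β φ =>
    (Real.continuous_rpow_const (by positivity)).mul
      (Real.continuous_cos.comp (by
        have := Real.continuous_rpow_const (q := (1 : ℝ) / 4) (by norm_num)
        fun_prop))
  have hpos : ∀ x ∈ Set.uIcc T (2 * T), 0 < x := fun x hx => by
    rw [Set.uIcc_of_le (by linarith)] at hx
    linarith [hx.1]
  rw [intervalIntegral.integral_congr fun x hx => R1_pow_eq c k (hpos x hx) y,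
    intervalIntegral.integral_const_mul, intervalIntegral.integral_finsetSum]
  · congr 1
    refine Finset.sum_congr rfl fun t _ => ?_
    rw [intervalIntegral.integral_finsetSum]
    · exact Finset.sum_congr rfl fun n _ => intervalIntegral.integral_const_mul _ _
    · exact fun n _ => ((hcont _ _).const_mul _).intervalIntegrable _ _
  · exact fun t _ => (continuous_finsetSum _ fun n _ =>
      (hcont _ _).const_mul _).intervalIntegrable _ _

theorem sum_mul_integral_eq (c : ℕ → ℝ) (y : ℝ) (t : Finset ι) (p T φ : ℝ) :
    ∑ n ∈ Fintype.piFinset fun _ : ι => Finset.Icc 1 ⌊y⌋₊,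
        tupleWeight c n * ∫ x in T..(2 * T),
          x ^ p * Real.cos (8 * π * signedRootSum t n * x ^ ((1 : ℝ) / 4) + φ) =
      (Real.cos φ * ∑ n ∈ Fintype.piFinset fun _ : ι => Finset.Icc 1 ⌊y⌋₊,
          (vanishingTuples t).indicator (tupleWeight c) n) * (∫ x in T..(2 * T), x ^ p) +
      ∑ n ∈ (Fintype.piFinset fun _ : ι => Finset.Icc 1 ⌊y⌋₊).filter
          (fun n => signedRootSum t n ≠ 0),
        tupleWeight c n * ∫ x in T..(2 * T),
          x ^ p * Real.cos (8 * π * signedRootSum t n * x ^ ((1 : ℝ) / 4) + φ) := by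
  rw [← Finset.sum_filter_add_sum_filter_not _ (fun n => signedRootSum t n = 0)]
  congr 1
  rw [Finset.mul_sum, Finset.sum_mul, Finset.sum_filter]
  refine Finset.sum_congr rfl fun n hn => ?_
  have hpos : ∀ j, 0 < n j := fun j => (Finset.mem_Icc.1 (Fintype.mem_piFinset.1 hn j)).1
  by_cases h0 : signedRootSum t n = 0
  · have hmem : n ∈ vanishingTuples t := ⟨hpos, h0⟩
    simp only [Set.indicator_of_mem hmem, h0, if_true, mul_zero, zero_mul, zero_add,
      intervalIntegral.integral_mul_const]
    ring
  · have hmem : n ∉ vanishingTuples t := fun h => h0 h.2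
    simp [if_neg h0, Set.indicator_of_notMem hmem]

theorem integral_rpow_mem_Icc {p T : ℝ} (hp : 0 ≤ p) (hT : 0 < T) :
    ∫ x in T..(2 * T), x ^ p ∈ Set.Icc 0 (2 ^ p * T ^ (1 + p)) := by
  have hle : T ≤ 2 * T := by linarith
  refine ⟨intervalIntegral.integral_nonneg hle fun x hx =>
    Real.rpow_nonneg (hT.le.trans hx.1) _, ?_⟩
  calc ∫ x in T..(2 * T), x ^ p ≤ ∫ _x in T..(2 * T), (2 * T) ^ p :=
        intervalIntegral.integral_mono_on hle
          ((Real.continuous_rpow_const hp).intervalIntegrable _ _) intervalIntegrable_const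
          fun x hx => Real.rpow_le_rpow (hT.le.trans hx.1) hx.2 hp
    _ = 2 ^ p * T ^ (1 + p) := by
        rw [intervalIntegral.integral_const, Real.mul_rpow (by norm_num) hT.le,
          Real.rpow_add hT, Real.rpow_one, smul_eq_mul]
        ring

end PowerMoment

theorem stmt_12 (c : ℕ → ℝ) (hc0 : ∀ n, 0 ≤ c n)
    (hc : ∀ ε : ℝ, 0 < ε → ∃ K : ℝ, 0 < K ∧ ∀ n : ℕ, 1 ≤ n → c n ≤ K * (n : ℝ) ^ ε)
    (k : ℕ) (hk : k = 3 ∨ k = 4 ∨ k = 5) (ε : ℝ) (hε : 0 < ε) :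
    ∃ C : ℝ, 0 < C ∧ ∀ T y : ℝ, 10 ≤ T → 2 ≤ y → y ≤ T →
      |(∫ x in T..(2 * T), (R1 c x y) ^ k) -
          BkRS c k / (2 ^ (3 * k - 1) * π ^ (2 * k)) * ∫ x in T..(2 * T), x ^ ((9 * k : ℝ) / 8)| ≤
        C * (T ^ (1 + 9 * (k : ℝ) / 8 + ε) * y ^ (-(3 : ℝ) / 4) +
          T ^ (3 / 4 + 9 * (k : ℝ) / 8 + ε) * y ^ ((4 : ℝ) ^ (k - 2) - 5 / 4 + (k : ℝ) / 8)) := by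
  have hk3 : 3 ≤ k := by omega
  have hι : 3 ≤ Fintype.card (Fin k) := by simpa using hk3
  have : Nonempty (Fin k) := ⟨⟨0, by omega⟩⟩
  set p : ℝ := (9 * k : ℝ) / 8 with hp
  have hk3' : (3 : ℝ) ≤ k := by exact_mod_cast hk3
  have hp1 : 1 / 4 ≤ p := by rw [hp]; linarith
  have hp0 : 0 ≤ p := by linarith
  obtain ⟨δ, hδ, hδ1, hδε⟩ : ∃ δ : ℝ, 0 < δ ∧ δ ≤ 3 / 4 ∧ δ ≤ ε :=
    ⟨min ε (3 / 4), lt_min hε (by norm_num), min_le_right _ _, min_le_left _ _⟩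
  choose C₁ hC₁0 hC₁ using fun t : Finset (Fin k) => exists_truncation_bound hc0 hc t hδ hδ1
  obtain ⟨C₂, hC₂0, hC₂⟩ := exists_oscillating_bound (ι := Fin k) hc0 hc hι hε hp1
  rw [Fintype.card_fin] at hC₂
  set D : ℝ := 1 / (8 * π ^ 2) ^ k with hD
  have hD0 : 0 < D := by positivity
  refine ⟨D * ∑ t : Finset (Fin k), (C₁ t * 2 ^ p + C₂) + 1, ?_, fun T y hT hy hyT => ?_⟩
  · have : 0 ≤ ∑ t : Finset (Fin k), (C₁ t * 2 ^ p + C₂) :=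
      Finset.sum_nonneg fun t _ => add_nonneg (mul_nonneg (hC₁0 t) (by positivity)) hC₂0
    positivity
  have hT0 : 0 < T := by linarith
  have hy0 : 0 < y := by linarith
  have hy1 : 1 ≤ y := by linarith
  obtain ⟨hJ0, hJ1⟩ := integral_rpow_mem_Icc hp0 hT0
  have hDB : BkRS c k / (2 ^ (3 * k - 1) * π ^ (2 * k)) = D * (2 * BkRS c k) := by
    obtain ⟨m, rfl⟩ : ∃ m, k = m + 1 := ⟨k - 1, by omega⟩
    rw [hD, mul_pow, ← pow_mul, show (8 : ℝ) = 2 ^ 3 by norm_num, ← pow_mul,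
      show 3 * (m + 1) = (3 * (m + 1) - 1) + 1 by omega, pow_succ]
    simp only [Nat.add_sub_cancel]
    field_simp
  rw [integral_R1_pow c k hT0 y, hDB, ← sum_cos_mul_tsum_eq c hk]
  simp only [← hp, sum_mul_integral_eq, Real.cos_neg]
  set J := ∫ x in T..(2 * T), x ^ p
  set F := T ^ (1 + 9 * (k : ℝ) / 8 + ε) * y ^ (-(3 : ℝ) / 4)
  set G := T ^ (3 / 4 + 9 * (k : ℝ) / 8 + ε) * y ^ ((4 : ℝ) ^ (k - 2) - 5 / 4 + (k : ℝ) / 8)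
  have hF0 : 0 ≤ F := by positivity
  have hG0 : 0 ≤ G := by positivity
  have hJF : J * y ^ (-(3 / 4 - δ)) ≤ 2 ^ p * F := by
    calc J * y ^ (-(3 / 4 - δ)) ≤ (2 ^ p * T ^ (1 + p)) * (y ^ (-(3 : ℝ) / 4) * T ^ ε) := by
          rw [show -(3 / 4 - δ) = -(3 : ℝ) / 4 + δ by ring, Real.rpow_add hy0]
          gcongr
          exact (Real.rpow_le_rpow_of_exponent_le hy1 hδε).trans
            (Real.rpow_le_rpow hy0.le hyT hε.le)
      _ = 2 ^ p * F := by
          simp only [F]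
          rw [Real.rpow_add hT0 (1 + 9 * (k : ℝ) / 8)]
          ring
  have hGle : y ^ ε * T ^ (p + 3 / 4) * y ^ ((4 : ℝ) ^ (k - 2) - 5 / 4 + (k : ℝ) / 8) ≤ G := by
    simp only [G]
    rw [show 3 / 4 + 9 * (k : ℝ) / 8 + ε = ε + (p + 3 / 4) by rw [hp]; ring,
      Real.rpow_add hT0 ε]
    gcongr
  rw [mul_assoc, ← mul_sub, Finset.sum_mul, ← Finset.sum_sub_distrib, abs_mul, abs_of_pos hD0]
  have hsum : ∀ a b S O : ℝ, a * S * J + O - a * b * J = a * ((S - b) * J) + O := by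
    intros; ring
  simp only [hsum]
  calc _ ≤ D * ∑ t : Finset (Fin k), (C₁ t * 2 ^ p + C₂) * (F + G) := by
        refine mul_le_mul_of_nonneg_left ((Finset.abs_sum_le_sum_abs _ _).trans
          (Finset.sum_le_sum fun t _ => ?_)) hD0.le
        refine (abs_add_le _ _).trans ?_
        rw [abs_mul, abs_mul, abs_of_nonneg hJ0]
        have h1 := (mul_le_mul_of_nonneg_right (hC₁ t y hy1) hJ0).trans_eq
          (mul_assoc _ _ _ |>.trans (congrArg _ (mul_comm _ _)))
        have h2 := h1.trans (mul_le_mul_of_nonneg_left hJF (hC₁0 t))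
        have h3 := (mul_le_of_le_one_left (by positivity)
          (Real.abs_cos_le_one (π / 4 * (2 * #t - k)))).trans h2
        refine (add_le_add h3 ((hC₂ T y hT0 hy1 t _).trans
          (mul_le_mul_of_nonneg_left hGle hC₂0))).trans ?_
        have := mul_nonneg (mul_nonneg (hC₁0 t) (by positivity : (0 : ℝ) ≤ 2 ^ p)) hG0
        have := mul_nonneg hC₂0 hF0
        linarith
    _ = (D * ∑ t : Finset (Fin k), (C₁ t * 2 ^ p + C₂)) * (F + G) := by
        rw [← Finset.sum_mul, mul_assoc]
    _ ≤ _ := by gcongr; linarith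
end

section
/- Let k ∈ {3,4,5} and ε > 0. There is a constant C > 0 such that for every real T ≥ 10 and every real y with 2 ≤ y ≤ T, one has |∫_T^{2T} S₃(x) dx| ≤ C · T^{1+9k/8+ε} y^{−3/4}, where S₃(x) = x^{9k/8} ∑_{i ∈ {0,1}^{k−1}} cos(−πβ(i)/4) ∑ c_{n₁}⋯c_{n_k}/(n₁⋯n_k)^{7/8}, the inner sum running over k-tuples (n₁,…,n_k) of positive integers with y < n₁ < 2ky, n_j ≤ y for 2 ≤ j ≤ k, and α(n;i) = 0. -/
open scoped Classical
open Real Finset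

/-- `α(n; i) = n₁^{1/4} + (−1)^{i₁} n₂^{1/4} + ⋯ + (−1)^{i_{k−1}} n_k^{1/4}`, encoded with a sign
bit for every index; the leading `+1` sign corresponds to the hypothesis `i 0 = false`. -/
noncomputable def alphaRS {k : ℕ} (n : Fin k → ℕ) (i : Fin k → Bool) : ℝ :=
  ∑ j, (if i j then (-1 : ℝ) else 1) * (n j : ℝ) ^ ((1 : ℝ) / 4)

/-- `β(i) = 1 + (−1)^{i₁} + ⋯ + (−1)^{i_{k−1}}`. -/
noncomputable def betaRS {k : ℕ} (i : Fin k → Bool) : ℝ :=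
  ∑ j, (if i j then (-1 : ℝ) else 1)

/-- An irrational positive real radical has trace zero in every real number field containing it. -/
theorem trace_eq_zero_of_irrational_of_pow_eq {K : IntermediateField ℚ ℝ} [FiniteDimensional ℚ K]
    {x : K} (hx : 0 < (x : ℝ)) {m : ℕ} (hm : m ≠ 0) {a : ℚ} (ha : (x : ℝ) ^ m = a)
    (hirr : Irrational (x : ℝ)) : Algebra.trace ℚ K x = 0 := by
  have hint : IsIntegral ℚ x := Algebra.IsIntegral.isIntegral x
  set d := (minpoly ℚ x).natDegree with hd
  have hd2 : 2 ≤ d := by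
    rw [hd, minpoly.two_le_natDegree_iff hint]
    rintro ⟨q, hq⟩
    apply hirr
    refine ⟨q, ?_⟩
    rw [← hq]
    simp
  set g := IntermediateField.AdjoinSimple.gen ℚ x with hg
  set r := Algebra.norm ℚ g with hr
  have hgm : g ^ m = algebraMap ℚ _ a := by
    apply Subtype.ext
    apply Subtype.ext
    simpa [hg] using ha
  have hrm : r ^ m = a ^ d := by
    rw [hr, ← map_pow, hgm, Algebra.norm_algebraMap, IntermediateField.adjoin.finrank hint]
  obtain ⟨b, hxd⟩ : ∃ b : ℚ, (x : ℝ) ^ d = b := by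
    refine ⟨|r|, ?_⟩
    refine (pow_left_inj₀ (by positivity) (by positivity) hm).1 ?_
    have ha0 : (0 : ℝ) < a := ha ▸ pow_pos hx m
    have h1 : ((|r| : ℚ) : ℝ) ^ m = |(a : ℝ) ^ d| := by
      rw [← Rat.cast_pow, ← abs_pow, hrm]
      push_cast
      rfl
    rw [h1, abs_of_pos (by positivity), ← ha, ← pow_mul, ← pow_mul, mul_comm]
  have hmin : minpoly ℚ x = Polynomial.X ^ d - Polynomial.C b := by
    symm
    refine Polynomial.eq_of_monic_of_dvd_of_natDegree_le (minpoly.monic hint)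
      (Polynomial.monic_X_pow_sub_C _ (by omega)) (minpoly.dvd _ _ ?_) ?_
    · apply Subtype.ext
      simp [hxd]
    · rw [Polynomial.natDegree_X_pow_sub_C]
  have hnext : (minpoly ℚ x).nextCoeff = 0 := by
    rw [Polynomial.nextCoeff_of_natDegree_pos (by omega), ← hd, hmin]
    rw [Polynomial.coeff_sub, Polynomial.coeff_X_pow, Polynomial.coeff_C]
    rw [if_neg (by omega), if_neg (by omega), sub_zero]
  rw [trace_eq_finrank_mul_minpoly_nextCoeff, hnext, neg_zero, mul_zero]

/-- In a vanishing rational combination of positive real radicals, every radical occurring in it is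
commensurable with another one. -/
theorem exists_ne_eq_ratCast_mul_of_sum_eq_zero {ι : Type*} [Fintype ι] {x : ι → ℝ}
    (hx : ∀ i, 0 < x i) {m : ℕ} (hm : m ≠ 0) (hpow : ∀ i, ∃ a : ℚ, x i ^ m = a) {s : ι → ℚ}
    (hs : ∑ i, (s i : ℝ) * x i = 0) {j : ι} (hj : s j ≠ 0) :
    ∃ l, l ≠ j ∧ ∃ r : ℚ, x l = r * x j := by
  by_contra! hcon
  have hypow : ∀ i, ∃ a : ℚ, (x i / x j) ^ m = a := by
    intro i
    obtain ⟨a, ha⟩ := hpow i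
    obtain ⟨b, hb⟩ := hpow j
    exact ⟨a / b, by rw [div_pow, ha, hb]; push_cast; rfl⟩
  have hint : ∀ z ∈ Set.range (fun i => x i / x j), IsIntegral ℚ z := by
    rintro _ ⟨i, rfl⟩
    obtain ⟨a, ha⟩ := hypow i
    refine IsIntegral.of_pow (Nat.pos_of_ne_zero hm) ?_
    rw [ha]
    exact isIntegral_algebraMap (A := ℝ) (x := a)
  let K := IntermediateField.adjoin ℚ (Set.range (fun i => x i / x j))
  have : FiniteDimensional ℚ K := IntermediateField.finiteDimensional_adjoin hint
  let Y : ι → K := fun i => ⟨x i / x j, IntermediateField.subset_adjoin _ _ ⟨i, rfl⟩⟩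
  have hY : ∑ i, s i • Y i = 0 := by
    apply Subtype.ext
    have h : ∑ i, (s i : ℝ) * (x i / x j) = 0 := by
      simp_rw [← mul_div_assoc]
      rw [← Finset.sum_div, hs, zero_div]
    simpa [Y, Rat.smul_def] using h
  have htr : ∀ i, i ≠ j → Algebra.trace ℚ K (Y i) = 0 := by
    intro i hi
    obtain ⟨a, ha⟩ := hypow i
    refine trace_eq_zero_of_irrational_of_pow_eq (div_pos (hx i) (hx j)) hm ha ?_
    rintro ⟨q, hq⟩
    refine hcon i hi q ?_
    rw [hq]
    exact (div_mul_cancel₀ _ (hx j).ne').symm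
  have h1 : Y j = 1 := Subtype.ext (div_self (hx j).ne')
  have h2 := congrArg (Algebra.trace ℚ K) hY
  rw [map_sum, map_zero, Finset.sum_eq_single j] at h2
  · rw [map_smul, h1, ← map_one (algebraMap ℚ K), Algebra.trace_algebraMap] at h2
    have := Module.finrank_pos (R := ℚ) (M := K)
    simp [hj, this.ne'] at h2
  · intro i _ hi
    rw [map_smul, htr i hi, smul_zero]
  · simp

/-- Two natural numbers whose ratio is the fourth power of a rational number. -/
def FourthPowerRel (m n : ℕ) : Prop :=
  ∃ u v : ℕ, 0 < u ∧ 0 < v ∧ m * u ^ 4 = n * v ^ 4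

theorem FourthPowerRel.symm {m n : ℕ} (h : FourthPowerRel m n) : FourthPowerRel n m := by
  obtain ⟨u, v, hu, hv, h⟩ := h
  exact ⟨v, u, hv, hu, h.symm⟩

theorem FourthPowerRel.trans {l m n : ℕ} (h : FourthPowerRel l m) (h' : FourthPowerRel m n) :
    FourthPowerRel l n := by
  obtain ⟨u, v, hu, hv, h⟩ := h
  obtain ⟨u', v', hu', hv', h'⟩ := h'
  refine ⟨u * u', v * v', by positivity, by positivity, ?_⟩
  calc l * (u * u') ^ 4 = (l * u ^ 4) * u' ^ 4 := by ring
    _ = (m * u' ^ 4) * v ^ 4 := by rw [h]; ring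
    _ = n * (v * v') ^ 4 := by rw [h']; ring

/-- The least positive integer whose ratio with `n` is a rational fourth power. -/
noncomputable def fourthPowerKernel (n : ℕ) : ℕ :=
  sInf {m | 0 < m ∧ FourthPowerRel m n}

theorem fourthPowerKernel_spec {n : ℕ} (hn : 0 < n) :
    0 < fourthPowerKernel n ∧ FourthPowerRel (fourthPowerKernel n) n :=
  Nat.sInf_mem (s := {m | 0 < m ∧ FourthPowerRel m n}) ⟨n, hn, 1, 1, one_pos, one_pos, rfl⟩

theorem fourthPowerKernel_congr {m n : ℕ} (h : FourthPowerRel m n) :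
    fourthPowerKernel m = fourthPowerKernel n := by
  unfold fourthPowerKernel
  congr 1
  ext l
  exact and_congr_right fun _ => ⟨fun hl => hl.trans h, fun hl => hl.trans h.symm⟩

theorem exists_eq_fourthPowerKernel_mul_pow {n : ℕ} (hn : 0 < n) :
    ∃ a, 0 < a ∧ n = fourthPowerKernel n * a ^ 4 := by
  obtain ⟨hq, u, v, hu, hv, h⟩ := fourthPowerKernel_spec hn
  obtain ⟨u', v', hcop, hu', hv'⟩ := Nat.exists_coprime u v
  have hg : 0 < u.gcd v := Nat.gcd_pos_of_pos_left _ hu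
  have hu0 : 0 < u' := Nat.pos_of_mul_pos_right (hu' ▸ hu)
  have hv0 : 0 < v' := Nat.pos_of_mul_pos_right (hv' ▸ hv)
  have h' : fourthPowerKernel n * u' ^ 4 = n * v' ^ 4 := by
    refine Nat.eq_of_mul_eq_mul_right (pow_pos hg 4) ?_
    rw [mul_assoc, mul_assoc, ← mul_pow, ← mul_pow, ← hu', ← hv', h]
  have hdvd : v' ^ 4 ∣ fourthPowerKernel n :=
    (Nat.Coprime.pow 4 4 hcop.symm).dvd_of_dvd_mul_right (Dvd.intro_left n h'.symm)
  obtain ⟨q', hq'⟩ := hdvd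
  have hq'0 : 0 < q' := Nat.pos_of_ne_zero (by rintro rfl; omega)
  have hle : fourthPowerKernel n ≤ q' := by
    refine Nat.sInf_le ⟨hq'0, u', 1, hu0, one_pos, ?_⟩
    refine Nat.eq_of_mul_eq_mul_left (pow_pos hv0 4) ?_
    rw [← mul_assoc, ← hq', h']
    ring
  have hv1 : v' ^ 4 ≤ 1 := by
    refine Nat.le_of_mul_le_mul_right ?_ hq'0
    rw [← hq', one_mul]
    exact hle
  have hv1' : v' ^ 4 = 1 := le_antisymm hv1 (pow_pos hv0 4)
  exact ⟨u', hu0, by rw [h', hv1', mul_one]⟩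

/-- In a vanishing signed sum of fourth roots, the ratio of every radicand with some other one is a
rational fourth power. -/
theorem exists_ne_fourthPowerRel_of_alphaRS_eq_zero {k : ℕ} {n : Fin k → ℕ} (hn : ∀ j, 0 < n j)
    {i : Fin k → Bool} (h : alphaRS n i = 0) (j : Fin k) :
    ∃ l, l ≠ j ∧ FourthPowerRel (n l) (n j) := by
  have hpow : ∀ l, ((n l : ℝ) ^ ((1 : ℝ) / 4)) ^ 4 = n l := by
    intro l
    rw [← Real.rpow_natCast, ← Real.rpow_mul (by positivity)]
    norm_num
  have hpos : ∀ l, 0 < (n l : ℝ) ^ ((1 : ℝ) / 4) := fun l =>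
    Real.rpow_pos_of_pos (by exact_mod_cast hn l) _
  obtain ⟨l, hlj, r, hr⟩ := exists_ne_eq_ratCast_mul_of_sum_eq_zero
    (x := fun l => (n l : ℝ) ^ ((1 : ℝ) / 4)) (m := 4) (s := fun l => if i l then -1 else 1) (j := j)
    hpos four_ne_zero (fun l => ⟨n l, by rw [hpow]; simp⟩)
    (by rw [← h, alphaRS]; refine Finset.sum_congr rfl fun l _ => ?_; split_ifs <;> simp)
    (by split_ifs <;> norm_num)
  refine ⟨l, hlj, r.den, r.num.natAbs, r.den_pos, ?_, ?_⟩
  · rw [Int.natAbs_pos, Rat.num_ne_zero]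
    rintro rfl
    simp only [Rat.cast_zero, zero_mul] at hr
    exact (hpos l).ne' hr
  · have h4 : (n l : ℝ) = (r : ℝ) ^ 4 * n j := by
      rw [← hpow l, ← hpow j, ← mul_pow]
      exact congrArg (· ^ 4) hr
    have h5 : (n l : ℚ) = r ^ 4 * n j := by exact_mod_cast h4
    have h6 : (n l : ℚ) * (r.den : ℚ) ^ 4 = n j * (r.num : ℚ) ^ 4 := by
      rw [h5, ← Rat.mul_den_eq_num r]
      ring
    have h7 : (r.num.natAbs : ℤ) ^ 4 = r.num ^ 4 := by
      rw [Int.natCast_natAbs]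
      exact Even.pow_abs ⟨2, rfl⟩ _
    have h8 : (n l : ℤ) * (r.den : ℤ) ^ 4 = n j * (r.num.natAbs : ℤ) ^ 4 := by
      rw [h7]
      exact_mod_cast h6
    exact_mod_cast h8

/-- If every term of `n` is related to another one by a rational fourth power, then `n` is
parametrized by kernels `z` and fourth powers, the kernels being counted at least twice in the
product of the terms. -/
theorem exists_fourthPower_parametrization {k : ℕ} [NeZero k] {n : Fin k → ℕ} (hn : ∀ j, 0 < n j)
    (h : ∀ j, ∃ l, l ≠ j ∧ FourthPowerRel (n l) (n j)) :
    ∃ (r : Fin k → Fin k) (z a : Fin k → ℕ), (∀ j, 0 < z j ∧ z j ≤ n j) ∧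
      (∀ j, 0 < a j ∧ a j ≤ n j) ∧ (∀ j, n j = z (r j) * a j ^ 4) ∧
      (∏ j, z j ^ 2) * ∏ j, a j ^ 4 ≤ ∏ j, n j := by
  set q : Fin k → ℕ := fun j => fourthPowerKernel (n j) with hq
  have hq0 : ∀ j, 0 < q j := fun j => (fourthPowerKernel_spec (hn j)).1
  choose a ha hna using fun j => exists_eq_fourthPowerKernel_mul_pow (hn j)
  have hqn : ∀ j, q j ≤ n j := fun j => by
    conv_rhs => rw [hna j]
    exact Nat.le_mul_of_pos_right _ (pow_pos (ha j) 4)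
  have han : ∀ j, a j ≤ n j := fun j => by
    conv_rhs => rw [hna j]
    exact (Nat.le_self_pow four_ne_zero _).trans (Nat.le_mul_of_pos_left _ (hq0 j))
  set r : Fin k → Fin k := fun j => Function.invFun q (q j) with hr
  have hqr : ∀ j, q (r j) = q j := fun j => Function.invFun_eq ⟨j, rfl⟩
  have hrr : ∀ j, r (r j) = r j := fun j => congrArg (Function.invFun q) (hqr j)
  set z : Fin k → ℕ := fun j => if r j = j then q j else 1 with hz
  have hzr : ∀ j, z (r j) = q j := fun j => by
    simp only [hz, hrr, if_true, hqr]
  refine ⟨r, z, a, fun j => ?_, fun j => ⟨ha j, han j⟩, fun j => (hzr j).symm ▸ hna j, ?_⟩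
  · simp only [hz]
    split_ifs
    exacts [⟨hq0 j, hqn j⟩, ⟨one_pos, hn j⟩]
  have hcard : ∀ b ∈ univ.image r, 2 ≤ #{j | r j = b} := by
    intro b hb
    obtain ⟨j, -, rfl⟩ := Finset.mem_image.1 hb
    obtain ⟨l, hl, hrel⟩ := h (r j)
    refine Finset.one_lt_card.2 ⟨r j, by simp [hrr], l, ?_, hl.symm⟩
    have h1 : q l = q (r j) := fourthPowerKernel_congr hrel
    simp only [Finset.mem_filter, Finset.mem_univ, true_and, hr]
    rw [h1, hqr]
  have hzq : ∏ j, z j ^ 2 ≤ ∏ j, q j := by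
    calc ∏ j, z j ^ 2 = ∏ b ∈ univ.image r, z b ^ 2 := by
          symm
          refine Finset.prod_subset (Finset.subset_univ _) fun b _ hb => ?_
          have : r b ≠ b := fun h => hb (Finset.mem_image.2 ⟨b, Finset.mem_univ _, h⟩)
          simp [hz, this]
      _ ≤ ∏ b ∈ univ.image r, q b ^ #{j | r j = b} := by
          refine Finset.prod_le_prod' fun b hb => ?_
          have h1 : z b = q b := by
            obtain ⟨j, -, rfl⟩ := Finset.mem_image.1 hb
            rw [hzr, hqr]
          rw [h1]
          exact Nat.pow_le_pow_right (hq0 b) (hcard b hb)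
      _ = ∏ j, q j := by
          rw [← Finset.prod_comp]
          exact Finset.prod_congr rfl fun j _ => hqr j
  calc (∏ j, z j ^ 2) * ∏ j, a j ^ 4 ≤ (∏ j, q j) * ∏ j, a j ^ 4 := Nat.mul_le_mul_right _ hzq
    _ = ∏ j, n j := by
      rw [← Finset.prod_mul_distrib]
      exact Finset.prod_congr rfl fun j _ => (hna j).symm

theorem sum_le_sum_of_forall_exists {α β : Type*} [DecidableEq β] {s : Finset α} {t : Finset β}
    {φ : β → α} {f : α → ℝ} {g : β → ℝ} (hg : ∀ b ∈ t, 0 ≤ g b)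
    (h : ∀ x ∈ s, ∃ b ∈ t, φ b = x ∧ f x ≤ g b) : ∑ x ∈ s, f x ≤ ∑ b ∈ t, g b := by
  rcases s.eq_empty_or_nonempty with rfl | ⟨x₀, hx₀⟩
  · simpa using Finset.sum_nonneg hg
  have : Nonempty β := ⟨(h x₀ hx₀).choose⟩
  choose! ψ hψt hψ hle using h
  have hinj : Set.InjOn ψ s := fun x hx y hy hxy => by rw [← hψ x hx, hxy, hψ y hy]
  calc ∑ x ∈ s, f x ≤ ∑ x ∈ s, g (ψ x) := Finset.sum_le_sum hle
    _ = ∑ b ∈ s.image ψ, g b := (Finset.sum_image hinj).symm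
    _ ≤ ∑ b ∈ t, g b := Finset.sum_le_sum_of_subset_of_nonneg
        (Finset.image_subset_iff.2 hψt) fun b hb _ => hg b hb

/-- Sums of `∏ (n j) ^ (-s)`, `s > 1 / 2`, over tuples in which every term is related to another
one by a rational fourth power are bounded. -/
theorem exists_sum_prod_rpow_neg_le (k : ℕ) [NeZero k] {s : ℝ} (hs : 1 / 2 < s) :
    ∃ C : ℝ, 0 < C ∧ ∀ S : Finset (Fin k → ℕ),
      (∀ n ∈ S, (∀ j, 0 < n j) ∧ ∀ j, ∃ l, l ≠ j ∧ FourthPowerRel (n l) (n j)) →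
      ∑ n ∈ S, (∏ j, (n j : ℝ)) ^ (-s) ≤ C := by
  have hsum : ∀ p : ℝ, 1 < p → Summable fun m : ℕ => (m : ℝ) ^ (-p) := fun p hp =>
    Real.summable_nat_rpow.2 (by linarith)
  set Z := ∑' m : ℕ, (m : ℝ) ^ (-(2 * s)) with hZ
  set A := ∑' m : ℕ, (m : ℝ) ^ (-(4 * s)) with hA
  refine ⟨Fintype.card (Fin k → Fin k) * (Z ^ k * A ^ k) + 1, ?_, fun S hS => ?_⟩
  · have hZ0 : 0 ≤ Z := tsum_nonneg fun m => by positivity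
    have hA0 : 0 ≤ A := tsum_nonneg fun m => by positivity
    positivity
  set I : Finset ℕ := Finset.Icc 1 (∑ n ∈ S, ∑ j, n j) with hI
  have hmem : ∀ n ∈ S, ∀ j (m : ℕ), 0 < m → m ≤ n j → m ∈ I := by
    intro n hn j m hm hmn
    refine Finset.mem_Icc.2 ⟨hm, hmn.trans ?_⟩
    exact (Finset.single_le_sum (f := n) (fun _ _ => Nat.zero_le _) (Finset.mem_univ j)).trans
      (Finset.single_le_sum (f := fun n : Fin k → ℕ => ∑ j, n j) (fun _ _ => Nat.zero_le _) hn)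
  set B : Finset (Fin k → ℕ) := Fintype.piFinset fun _ => I with hB
  have hbox : ∀ p : ℝ, 1 < p →
      ∑ z ∈ B, ∏ j, (z j : ℝ) ^ (-p) ≤ (∑' m : ℕ, (m : ℝ) ^ (-p)) ^ k := by
    intro p hp
    rw [hB, ← Finset.prod_univ_sum (fun _ => I) (fun _ m => (m : ℝ) ^ (-p)), Finset.prod_const,
      Finset.card_univ, Fintype.card_fin]
    refine pow_le_pow_left₀ (Finset.sum_nonneg fun m _ => by positivity) ?_ k
    exact (hsum p hp).sum_le_tsum _ fun m _ => by positivity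
  have hmain : ∑ n ∈ S, (∏ j, (n j : ℝ)) ^ (-s) ≤
      ∑ b ∈ (univ : Finset (Fin k → Fin k)) ×ˢ (B ×ˢ B),
        (∏ j, (b.2.1 j : ℝ) ^ (-(2 * s))) * ∏ j, (b.2.2 j : ℝ) ^ (-(4 * s)) := by
    refine sum_le_sum_of_forall_exists (φ := fun b j => b.2.1 (b.1 j) * b.2.2 j ^ 4)
      (fun b _ => by positivity) fun n hn => ?_
    obtain ⟨r, z, a, hz, ha, hza, hprod⟩ :=
      exists_fourthPower_parametrization (hS n hn).1 (hS n hn).2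
    refine ⟨(r, z, a), ?_, (funext hza).symm, ?_⟩
    · simp only [hB, Finset.mem_product, Finset.mem_univ, true_and, Fintype.mem_piFinset]
      exact ⟨fun j => hmem n hn j _ (hz j).1 (hz j).2, fun j => hmem n hn j _ (ha j).1 (ha j).2⟩
    · have hrw : ∀ (w : Fin k → ℕ) (e : ℕ), ∏ j, (w j : ℝ) ^ (-(e * s)) =
          (∏ j, (w j : ℝ) ^ e) ^ (-s) := by
        intro w e
        rw [← Real.finsetProd_rpow _ _ fun j _ => by positivity]
        refine Finset.prod_congr rfl fun j _ => ?_
        rw [← Real.rpow_natCast, ← Real.rpow_mul (by positivity)]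
        congr 1
        ring
      have h2 := hrw z 2
      have h4 := hrw a 4
      push_cast at h2 h4
      rw [h2, h4, ← Real.mul_rpow (by positivity) (by positivity)]
      have hz0 : ∀ j, (0 : ℝ) < z j := fun j => by exact_mod_cast (hz j).1
      have ha0 : ∀ j, (0 : ℝ) < a j := fun j => by exact_mod_cast (ha j).1
      refine Real.rpow_le_rpow_of_nonpos ?_ (by exact_mod_cast hprod) (by linarith)
      exact mul_pos (Finset.prod_pos fun j _ => pow_pos (hz0 j) _)
        (Finset.prod_pos fun j _ => pow_pos (ha0 j) _)
  refine hmain.trans ?_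
  rw [Finset.sum_product]
  dsimp only
  rw [Finset.sum_const, Finset.card_univ, nsmul_eq_mul, Finset.sum_product]
  simp_rw [← Finset.mul_sum]
  rw [← Finset.sum_mul]
  refine le_add_of_le_of_nonneg ?_ zero_le_one
  gcongr
  · exact hbox _ (by linarith)
  · exact hbox _ (by linarith)

/-- In a vanishing signed sum of fourth roots, no radicand is large compared with the product of
the other ones. -/
theorem sq_le_pow_four_mul_prod_of_alphaRS_eq_zero {k : ℕ} {n : Fin k → ℕ} (hn : ∀ j, 0 < n j)
    {i : Fin k → Bool} (h : alphaRS n i = 0) (j : Fin k) :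
    (n j : ℝ) ^ 2 ≤ (k : ℝ) ^ 4 * ∏ l, (n l : ℝ) := by
  set P : ℝ := ∏ l ∈ univ.erase j, (n l : ℝ) with hP
  have hP0 : 0 ≤ P := Finset.prod_nonneg fun l _ => by positivity
  have hle : ∀ l ∈ univ.erase j, (n l : ℝ) ≤ P := by
    intro l hl
    rw [hP, ← Finset.mul_prod_erase _ _ hl]
    refine le_mul_of_one_le_right (by positivity) ?_
    exact_mod_cast Finset.one_le_prod' fun l _ => hn l
  set e : Fin k → ℝ := fun l => if i l then -1 else 1 with he
  have he1 : ∀ l, |e l| = 1 := fun l => by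
    simp only [he]
    split_ifs <;> simp
  have hroot : (n j : ℝ) ^ ((1 : ℝ) / 4) ≤ k * P ^ ((1 : ℝ) / 4) := by
    have h0 : e j * (n j : ℝ) ^ ((1 : ℝ) / 4) =
        -∑ l ∈ univ.erase j, e l * (n l : ℝ) ^ ((1 : ℝ) / 4) := by
      rw [eq_neg_iff_add_eq_zero, ← h, alphaRS]
      exact Finset.add_sum_erase univ (fun l => e l * (n l : ℝ) ^ ((1 : ℝ) / 4))
        (Finset.mem_univ j)
    calc (n j : ℝ) ^ ((1 : ℝ) / 4) = |e j * (n j : ℝ) ^ ((1 : ℝ) / 4)| := by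
          rw [abs_mul, he1, one_mul, abs_of_nonneg (by positivity)]
      _ ≤ ∑ l ∈ univ.erase j, |e l * (n l : ℝ) ^ ((1 : ℝ) / 4)| := by
          rw [h0, abs_neg]
          exact Finset.abs_sum_le_sum_abs _ _
      _ ≤ ∑ _l ∈ univ.erase j, P ^ ((1 : ℝ) / 4) := by
          refine Finset.sum_le_sum fun l hl => ?_
          rw [abs_mul, he1, one_mul, abs_of_nonneg (by positivity)]
          exact Real.rpow_le_rpow (by positivity) (hle l hl) (by norm_num)
      _ ≤ k * P ^ ((1 : ℝ) / 4) := by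
          rw [Finset.sum_const, nsmul_eq_mul]
          refine mul_le_mul_of_nonneg_right ?_ (by positivity)
          exact_mod_cast (Finset.card_le_univ _).trans_eq (Fintype.card_fin k)
  have hfour : ∀ x : ℝ, 0 ≤ x → (x ^ ((1 : ℝ) / 4)) ^ 4 = x := fun x hx => by
    rw [← Real.rpow_natCast, ← Real.rpow_mul hx]
    norm_num
  have hmain : (n j : ℝ) ≤ (k : ℝ) ^ 4 * P := by
    have := pow_le_pow_left₀ (by positivity) hroot 4
    rwa [mul_pow, hfour _ (by positivity), hfour _ hP0] at this
  rw [← Finset.mul_prod_erase _ _ (Finset.mem_univ j), sq, mul_left_comm]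
  exact mul_le_mul_of_nonneg_left hmain (by positivity)

theorem exists_sum_prod_div_le {c : ℕ → ℝ} (hc0 : ∀ n, 0 ≤ c n)
    (hc : ∀ ε : ℝ, 0 < ε → ∃ K : ℝ, 0 < K ∧ ∀ n : ℕ, 1 ≤ n → c n ≤ K * (n : ℝ) ^ ε)
    (k : ℕ) [NeZero k] {ε : ℝ} (hε : 0 < ε) :
    ∃ C : ℝ, 0 < C ∧ ∀ y : ℝ, 0 < y → ∀ (S : Finset (Fin k → ℕ)) (j : Fin k) (i : Fin k → Bool),
      (∀ n ∈ S, (∀ l, 0 < n l ∧ (n l : ℝ) ≤ 2 * k * y) ∧ y ≤ n j ∧ alphaRS n i = 0) →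
      ∑ n ∈ S, (∏ l, c (n l)) / (∏ l, (n l : ℝ)) ^ ((7 : ℝ) / 8) ≤
        C * y ^ ε * y ^ (-(3 : ℝ) / 4) := by
  have hk : (0 : ℝ) < k := by exact_mod_cast Nat.pos_of_neZero k
  set δ : ℝ := ε / (2 * k) with hδ
  have hδ0 : 0 < δ := by positivity
  obtain ⟨K, hK0, hK⟩ := hc δ hδ0
  obtain ⟨C, hC0, hC⟩ := exists_sum_prod_rpow_neg_le k (s := 1 / 2 + δ) (by linarith)
  set M : ℝ := K ^ k * ((k : ℝ) ^ 4) ^ ((3 : ℝ) / 8) * (2 * k) ^ ε with hM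
  have hM0 : 0 < M := by positivity
  refine ⟨M * C, by positivity, fun y hy S j i hS => ?_⟩
  have hterm : ∀ n ∈ S, (∏ l, c (n l)) / (∏ l, (n l : ℝ)) ^ ((7 : ℝ) / 8) ≤
      M * y ^ ε * y ^ (-(3 : ℝ) / 4) * (∏ l, (n l : ℝ)) ^ (-(1 / 2 + δ)) := by
    intro n hnS
    obtain ⟨hn, hyn, hα⟩ := hS n hnS
    have hn0 : ∀ l, (0 : ℝ) < n l := fun l => by exact_mod_cast (hn l).1
    have hsq := sq_le_pow_four_mul_prod_of_alphaRS_eq_zero (fun l => (hn l).1) hα j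
    set P : ℝ := ∏ l, (n l : ℝ) with hP
    have hP0 : 0 < P := Finset.prod_pos fun l _ => hn0 l
    have hcP : ∏ l, c (n l) ≤ K ^ k * P ^ δ := by
      calc ∏ l, c (n l) ≤ ∏ l, K * (n l : ℝ) ^ δ :=
            Finset.prod_le_prod (fun l _ => hc0 _) fun l _ => hK _ (hn l).1
        _ = K ^ k * P ^ δ := by
            rw [Finset.prod_mul_distrib, Finset.prod_const, Finset.card_univ, Fintype.card_fin,
              Real.finsetProd_rpow _ _ fun l _ => (hn0 l).le]
    have hPy : P ≤ (2 * k * y) ^ k := by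
      calc P ≤ ∏ _l : Fin k, (2 * k * y) :=
            Finset.prod_le_prod (fun l _ => (hn0 l).le) fun l _ => (hn l).2
        _ = (2 * k * y) ^ k := by
            rw [Finset.prod_const, Finset.card_univ, Fintype.card_fin]
    have hPε : P ^ (2 * δ) ≤ (2 * k) ^ ε * y ^ ε := by
      calc P ^ (2 * δ) ≤ ((2 * k * y) ^ k) ^ (2 * δ) :=
            Real.rpow_le_rpow hP0.le hPy (by positivity)
        _ = (2 * k * y) ^ ε := by
            rw [← Real.rpow_natCast, ← Real.rpow_mul (by positivity), hδ]
            congr 1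
            field_simp
        _ = (2 * k) ^ ε * y ^ ε := Real.mul_rpow (by positivity) hy.le
    have hy34 : 1 ≤ ((k : ℝ) ^ 4) ^ ((3 : ℝ) / 8) * P ^ ((3 : ℝ) / 8) * y ^ (-(3 : ℝ) / 4) := by
      have h1 : y ^ ((3 : ℝ) / 4) ≤ ((k : ℝ) ^ 4) ^ ((3 : ℝ) / 8) * P ^ ((3 : ℝ) / 8) := by
        rw [← Real.mul_rpow (by positivity) hP0.le]
        calc y ^ ((3 : ℝ) / 4) = (y ^ 2) ^ ((3 : ℝ) / 8) := by
              rw [← Real.rpow_natCast, ← Real.rpow_mul hy.le]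
              norm_num
          _ ≤ _ := Real.rpow_le_rpow (by positivity)
              ((pow_le_pow_left₀ hy.le hyn 2).trans hsq) (by norm_num)
      rw [neg_div, Real.rpow_neg hy.le, ← div_eq_mul_inv, one_le_div (by positivity)]
      exact h1
    calc (∏ l, c (n l)) / P ^ ((7 : ℝ) / 8) ≤ K ^ k * P ^ δ / P ^ ((7 : ℝ) / 8) := by gcongr
      _ ≤ K ^ k * P ^ δ / P ^ ((7 : ℝ) / 8) *
          (((k : ℝ) ^ 4) ^ ((3 : ℝ) / 8) * P ^ ((3 : ℝ) / 8) * y ^ (-(3 : ℝ) / 4)) :=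
          le_mul_of_one_le_right (by positivity) hy34
      _ = K ^ k * ((k : ℝ) ^ 4) ^ ((3 : ℝ) / 8) * y ^ (-(3 : ℝ) / 4) *
          (P ^ (2 * δ) * P ^ (-(1 / 2 + δ))) := by
          have : P ^ (2 * δ) * P ^ (-(1 / 2 + δ)) =
              P ^ δ / P ^ ((7 : ℝ) / 8) * P ^ ((3 : ℝ) / 8) := by
            rw [← Real.rpow_add hP0, ← Real.rpow_sub hP0, ← Real.rpow_add hP0]
            congr 1
            ring
          rw [this]
          ring
      _ ≤ K ^ k * ((k : ℝ) ^ 4) ^ ((3 : ℝ) / 8) * y ^ (-(3 : ℝ) / 4) *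
          ((2 * k) ^ ε * y ^ ε * P ^ (-(1 / 2 + δ))) := by gcongr
      _ = _ := by rw [hM]; ring
  calc _ ≤ ∑ n ∈ S, M * y ^ ε * y ^ (-(3 : ℝ) / 4) * (∏ l, (n l : ℝ)) ^ (-(1 / 2 + δ)) :=
        Finset.sum_le_sum hterm
    _ = M * y ^ ε * y ^ (-(3 : ℝ) / 4) * ∑ n ∈ S, (∏ l, (n l : ℝ)) ^ (-(1 / 2 + δ)) :=
        (Finset.mul_sum _ _ _).symm
    _ ≤ M * y ^ ε * y ^ (-(3 : ℝ) / 4) * C := by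
        refine mul_le_mul_of_nonneg_left (hC S fun n hn => ?_) (by positivity)
        obtain ⟨hn, -, hα⟩ := hS n hn
        exact ⟨fun l => (hn l).1,
          exists_ne_fourthPowerRel_of_alphaRS_eq_zero (fun l => (hn l).1) hα⟩
    _ = _ := by ring

theorem stmt_13 (c : ℕ → ℝ) (hc0 : ∀ n, 0 ≤ c n)
    (hc : ∀ ε : ℝ, 0 < ε → ∃ K : ℝ, 0 < K ∧ ∀ n : ℕ, 1 ≤ n → c n ≤ K * (n : ℝ) ^ ε)
    (k : ℕ) (hk : k = 3 ∨ k = 4 ∨ k = 5) (ε : ℝ) (hε : 0 < ε) :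
    ∃ C : ℝ, 0 < C ∧ ∀ T y : ℝ, 10 ≤ T → 2 ≤ y → y ≤ T →
      |∫ x in T..(2 * T),
          x ^ ((9 * k : ℝ) / 8) *
            ∑ i ∈ Finset.univ.filter (fun i : Fin k → Bool => i ⟨0, by omega⟩ = false),
              Real.cos (-(π * betaRS i) / 4) *
                ∑ n ∈ Fintype.piFinset (fun j : Fin k =>
                    if (j : ℕ) = 0 then Finset.Ioc ⌊y⌋₊ ⌊2 * (k : ℝ) * y⌋₊
                    else Finset.Icc 1 ⌊y⌋₊),
                  (if (n ⟨0, by omega⟩ : ℝ) < 2 * (k : ℝ) * y ∧ alphaRS n i = 0 then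
                    (∏ j, c (n j)) / (∏ j, (n j : ℝ)) ^ ((7 : ℝ) / 8) else 0)| ≤
        C * T ^ (1 + 9 * (k : ℝ) / 8 + ε) * y ^ (-(3 : ℝ) / 4) := by
  have : NeZero k := ⟨by omega⟩
  have hk1 : (1 : ℝ) ≤ k := by exact_mod_cast Nat.pos_of_neZero k
  obtain ⟨C, hC0, hC⟩ := exists_sum_prod_div_le hc0 hc k hε
  refine ⟨2 ^ ((9 * k : ℝ) / 8) * (Fintype.card (Fin k → Bool) * C), by positivity,
    fun T y hT hy hyT => ?_⟩
  have hT0 : 0 < T := by linarith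
  have hy0 : 0 < y := by linarith
  set D : ℝ := C * T ^ ε * y ^ (-(3 : ℝ) / 4) with hD
  have hD0 : 0 < D := by positivity
  have hkey := intervalIntegral.norm_integral_le_of_norm_le_const (a := T) (b := 2 * T)
    (C := (2 * T) ^ ((9 * k : ℝ) / 8) * (Fintype.card (Fin k → Bool) * D))
    (f := fun x => x ^ ((9 * k : ℝ) / 8) *
            ∑ i ∈ Finset.univ.filter (fun i : Fin k → Bool => i ⟨0, by omega⟩ = false),
              Real.cos (-(π * betaRS i) / 4) *
                ∑ n ∈ Fintype.piFinset (fun j : Fin k =>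
                    if (j : ℕ) = 0 then Finset.Ioc ⌊y⌋₊ ⌊2 * (k : ℝ) * y⌋₊
                    else Finset.Icc 1 ⌊y⌋₊),
                  (if (n ⟨0, by omega⟩ : ℝ) < 2 * (k : ℝ) * y ∧ alphaRS n i = 0 then
                    (∏ j, c (n j)) / (∏ j, (n j : ℝ)) ^ ((7 : ℝ) / 8) else 0)) ?_
  · rw [Real.norm_eq_abs] at hkey
    refine hkey.trans_eq ?_
    rw [show 2 * T - T = T by ring, abs_of_pos hT0, Real.mul_rpow zero_le_two hT0.le, hD,
      Real.rpow_add hT0, Real.rpow_add hT0, Real.rpow_one]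
    ring
  · intro x hx
    rw [Set.uIoc_of_le (by linarith)] at hx
    have hx0 : 0 < x := hT0.trans hx.1
    rw [norm_mul, Real.norm_of_nonneg (by positivity)]
    refine mul_le_mul (Real.rpow_le_rpow hx0.le hx.2 (by positivity)) ?_ (norm_nonneg _)
      (by positivity)
    refine (norm_sum_le_of_le (f := fun i : Fin k → Bool => _) _ (n := fun _ => D)
      fun i _ => ?_).trans ?_
    · rw [norm_mul, ← Finset.sum_filter, Real.norm_of_nonneg (Finset.sum_nonneg fun n _ =>
        div_nonneg (Finset.prod_nonneg fun j _ => hc0 _) (by positivity))]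
      refine (mul_le_of_le_one_left (Finset.sum_nonneg fun n _ =>
        div_nonneg (Finset.prod_nonneg fun j _ => hc0 _) (by positivity))
        (Real.abs_cos_le_one _)).trans ?_
      refine (hC y hy0 _ ⟨0, by omega⟩ i fun n hn => ?_).trans ?_
      · obtain ⟨hn, hlt, hα⟩ := Finset.mem_filter.1 hn
        rw [Fintype.mem_piFinset] at hn
        have hn0 := hn ⟨0, by omega⟩
        rw [if_pos rfl, Finset.mem_Ioc, Nat.floor_lt hy0.le] at hn0
        refine ⟨fun l => ?_, hn0.1.le, hα⟩
        have hnl := hn l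
        split_ifs at hnl with hl
        · rw [Finset.mem_Ioc] at hnl
          exact ⟨by omega, (Nat.le_floor_iff (by positivity)).1 hnl.2⟩
        · rw [Finset.mem_Icc] at hnl
          exact ⟨hnl.1, ((Nat.le_floor_iff hy0.le).1 hnl.2).trans (by nlinarith)⟩
      · rw [hD]
        gcongr
    · rw [Finset.sum_const, nsmul_eq_mul]
      gcongr
      exact Finset.card_le_univ _
end
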